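/- arXiv:2307.09645 — 10 statements merged into one kernel-verified Lean document; each statement's English description precedes it below -/
import Mathlib

section
/- Let M be an atomic co-well-ordered positive monoid. Then for every x ∈ M and every ℓ ∈ ℕ, every irredundant subset of the set Z_ℓ(x) of length-ℓ factorizations of x is finite. That is, any family of multisets of atoms of M, each of cardinality ℓ and each summing to x, whose members are pairwise disjoint (no two share an atom), is finite. -/
/-- `a` is an (additive) atom of the set `M ⊆ ℝ`. -/
def IsAddAtom (M : Set ℝ) (a : ℝ) : Prop :=
  a ∈ M ∧ a ≠ 0 ∧ ∀ b ∈ M, ∀ c ∈ M, a = b + c → b = 0 ∨ c = 0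

/-- The factorizations of `x` in `M`: multisets of atoms of `M` summing to `x`. -/
def AddFactorizations (M : Set ℝ) (x : ℝ) : Set (Multiset ℝ) :=
  {s | (∀ a ∈ s, IsAddAtom M a) ∧ s.sum = x}

/-- `M` is atomic: every nonzero element has a factorization into atoms. -/
def IsAddAtomic (M : Set ℝ) : Prop :=
  ∀ x ∈ M, x ≠ 0 → (AddFactorizations M x).Nonempty

/-- A sequence of real numbers is co-well-ordered if it contains no strictly
increasing subsequence. -/
def CoWellOrdered (f : ℕ → ℝ) : Prop :=
  ¬ ∃ φ : ℕ → ℕ, StrictMono φ ∧ StrictMono (f ∘ φ)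

/-- An atom of the monoid generated by `S` lies in `S`. -/
theorem IsAddAtom.mem_of_closure {S : Set ℝ} {a : ℝ}
    (ha : IsAddAtom (AddSubmonoid.closure S : Set ℝ) a) : a ∈ S := by
  obtain ⟨hmem, hne, hirred⟩ := ha
  induction hmem using AddSubmonoid.closure_induction with
  | mem y hy => exact hy
  | zero => exact absurd rfl hne
  | add y z hy hz ihy ihz =>
    rcases hirred y hy z hz rfl with rfl | rfl
    · rw [zero_add] at hne hirred ⊢
      exact ihz hne hirred
    · rw [add_zero] at hne hirred ⊢
      exact ihy hne hirred

/-- The range of a co-well-ordered sequence is partially well-ordered in the dual order. -/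
theorem CoWellOrdered.isPWO_range {f : ℕ → ℝ} (hf : CoWellOrdered f) :
    (OrderDual.ofDual ⁻¹' Set.range f : Set ℝᵒᵈ).IsPWO := by
  intro g
  by_contra! hcon
  choose k hk using fun n => (g n).2
  have hmono : StrictMono (f ∘ k) := fun m n hmn => by
    have h : ¬ OrderDual.ofDual (g n).1 ≤ OrderDual.ofDual (g m).1 := hcon m n hmn
    rw [← hk, ← hk] at h
    exact not_le.mp h
  have hinj : Function.Injective k := hmono.injective.of_comp
  obtain ⟨φ, hφ, hkφ⟩ := Filter.strictMono_subseq_of_tendsto_atTop hinj.nat_tendsto_atTop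
  exact hf ⟨k ∘ φ, hkφ, hmono.comp hφ⟩

/-- If `A` is partially well-ordered in the dual order, then only finitely many multisets of
fixed cardinality with elements in `A` have a given sum. -/
theorem finite_multisets_of_isPWO_dual {A : Set ℝ}
    (hA : (OrderDual.ofDual ⁻¹' A : Set ℝᵒᵈ).IsPWO) (x : ℝ) (ℓ : ℕ) :
    {s : Multiset ℝ | (∀ a ∈ s, a ∈ A) ∧ s.sum = x ∧ Multiset.card s = ℓ}.Finite := by
  let T : Set (Fin ℓ → ℝᵒᵈ) :=
    {v | (∀ i, OrderDual.ofDual (v i) ∈ A) ∧ ∑ i, OrderDual.ofDual (v i) = x}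
  have hT : T.Finite := by
    have hpwo : T.IsPWO :=
      (Set.IsPWO.pi (s := fun _ : Fin ℓ => OrderDual.ofDual ⁻¹' A) fun _ => hA).mono
        fun v hv i _ => hv.1 i
    refine IsAntichain.finite_of_partiallyWellOrderedOn ?_ hpwo
    intro v hv w hw hne hle
    refine hne (funext fun i => ?_)
    have h := (Finset.sum_eq_sum_iff_of_le (s := Finset.univ)
      (f := fun i => OrderDual.ofDual (w i)) (g := fun i => OrderDual.ofDual (v i))
      fun i _ => hle i).1 (hw.2.trans hv.2.symm)
    exact (h i (Finset.mem_univ i)).symm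
  refine (hT.image fun v => (List.ofFn fun i => OrderDual.ofDual (v i) : Multiset ℝ)).subset ?_
  rintro s ⟨hmem, hsum, hcard⟩
  induction s using Quotient.inductionOn with
  | h l =>
    obtain rfl : l.length = ℓ := hcard
    refine ⟨fun i => OrderDual.toDual (l.get i), ⟨fun i => hmem _ (List.get_mem l i), ?_⟩, ?_⟩
    · rw [← hsum]
      simp [← List.sum_ofFn]
    · simp

/-- Let `M` be an atomic co-well-ordered positive monoid. Then for every `x ∈ M` and
every `ℓ ∈ ℕ`, every irredundant subset of `Z_ℓ(x)` (a family of length-`ℓ`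
factorizations of `x` that pairwise share no atoms) is finite. -/
theorem irredundant_subset_of_factorizations_finite
    (M : AddSubmonoid ℝ) (hpos : ∀ x ∈ M, (0 : ℝ) ≤ x)
    (hatomic : IsAddAtomic (M : Set ℝ))
    (hcwo : ∃ f : ℕ → ℝ, CoWellOrdered f ∧ AddSubmonoid.closure (Set.range f) = M)
    (x : ℝ) (hx : x ∈ M) (ℓ : ℕ)
    (Z : Set (Multiset ℝ))
    (hZ : ∀ s ∈ Z, s ∈ AddFactorizations (M : Set ℝ) x ∧ Multiset.card s = ℓ)
    (hirr : ∀ s ∈ Z, ∀ t ∈ Z, s ≠ t → ∀ a, a ∈ s → a ∉ t) :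
    Z.Finite := by
  obtain ⟨f, hf, rfl⟩ := hcwo
  refine (finite_multisets_of_isPWO_dual hf.isPWO_range x ℓ).subset fun s hs => ?_
  obtain ⟨⟨hatom, hsum⟩, hcard⟩ := hZ s hs
  exact ⟨fun a ha => (hatom a ha).mem_of_closure, hsum, hcard⟩
end

section
/- Every atomic co-well-ordered positive monoid is a length-finite factorization monoid (LFFM); that is, if M is an atomic positive monoid generated by the terms of a sequence containing no strictly increasing subsequence, then for every x ∈ M and every ℓ ∈ ℕ the set of length-ℓ factorizations of x is finite. -/
/-- `M` is a length-finite factorization monoid: it is atomic, and every element has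
only finitely many factorizations of each fixed length. -/
def IsLFFM (M : Set ℝ) : Prop :=
  IsAddAtomic M ∧
    ∀ x ∈ M, ∀ ℓ : ℕ, {s ∈ AddFactorizations M x | Multiset.card s = ℓ}.Finite

/-- An atom of a submonoid lies in every generating set. -/
theorem IsAddAtom.mem_of_closure_eq {M : AddSubmonoid ℝ} {S : Set ℝ}
    (hS : AddSubmonoid.closure S = M) {a : ℝ} (ha : IsAddAtom (M : Set ℝ) a) : a ∈ S := by
  have haS : a ∈ AddSubmonoid.closure S := hS ▸ ha.1
  induction haS using AddSubmonoid.closure_induction with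
  | mem x hx => exact hx
  | zero => exact absurd rfl ha.2.1
  | add x y hx hy ihx ihy =>
    rcases ha.2.2 x (hS ▸ hx) y (hS ▸ hy) rfl with rfl | rfl
    · rw [zero_add] at ha ⊢
      exact ihy ha
    · rw [add_zero] at ha ⊢
      exact ihx ha

/-- The range of a co-well-ordered sequence is well-quasi-ordered by `≥`. -/
theorem CoWellOrdered.partiallyWellOrderedOn_range {f : ℕ → ℝ} (hf : CoWellOrdered f) :
    (Set.range f).PartiallyWellOrderedOn (· ≥ ·) := by
  rw [Set.partiallyWellOrderedOn_iff_exists_lt]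
  intro g hg
  choose k hk using hg
  by_contra! h
  have hmono : StrictMono g := fun m n hmn => h m n hmn
  have hinj : Function.Injective k := fun m n hmn => hmono.injective <| by
    rw [← hk m, ← hk n, hmn]
  obtain ⟨φ, hφ, hkφ⟩ := Filter.strictMono_subseq_of_tendsto_atTop hinj.nat_tendsto_atTop
  refine hf ⟨k ∘ φ, hkφ, fun m n hmn => ?_⟩
  simpa only [Function.comp_apply, hk] using hmono (hφ hmn)

/-- In a set of reals that is well-quasi-ordered by `≥`, only finitely many multisets have a given
cardinality and a given sum. -/
theorem Set.PartiallyWellOrderedOn.finite_multiset_card_sum {S : Set ℝ}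
    (hS : S.PartiallyWellOrderedOn (· ≥ ·)) (x : ℝ) (l : ℕ) :
    {s : Multiset ℝ | (∀ a ∈ s, a ∈ S) ∧ s.sum = x ∧ Multiset.card s = l}.Finite := by
  let T : Set (Fin l → ℝ) := {v | (∀ i, v i ∈ S) ∧ ∑ i, v i = x}
  have hT : T.PartiallyWellOrderedOn fun v w => ∀ i, v i ≥ w i :=
    (Set.PartiallyWellOrderedOn.pi fun _ : Fin l => hS).mono fun v hv i _ => hv.1 i
  have hanti : IsAntichain (fun v w : Fin l → ℝ => ∀ i, v i ≥ w i) T := by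
    intro v hv w hw hne hle
    refine hne (funext fun i => ?_)
    exact ((Finset.sum_eq_sum_iff_of_le fun i _ => hle i).1 (hw.2.trans hv.2.symm) i
      (Finset.mem_univ i)).symm
  refine ((hanti.finite_of_partiallyWellOrderedOn hT).image
    fun v => (List.ofFn v : Multiset ℝ)).subset ?_
  rintro s ⟨hs, hsum, hcard⟩
  obtain ⟨L, rfl⟩ : ∃ L : List ℝ, (L : Multiset ℝ) = s := Quot.exists_rep s
  obtain rfl : L.length = l := hcard
  refine ⟨L.get, ⟨fun i => hs _ (List.get_mem L i), ?_⟩, by simp⟩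
  rw [← List.sum_ofFn]
  simpa using hsum

/-- Every atomic co-well-ordered positive monoid is an LFFM. -/
theorem atomic_coWellOrdered_positiveMonoid_isLFFM
    (M : AddSubmonoid ℝ) (hpos : ∀ x ∈ M, (0 : ℝ) ≤ x)
    (hatomic : IsAddAtomic (M : Set ℝ))
    (hcwo : ∃ f : ℕ → ℝ, CoWellOrdered f ∧ AddSubmonoid.closure (Set.range f) = M) :
    IsLFFM (M : Set ℝ) := by
  obtain ⟨f, hf, hgen⟩ := hcwo
  refine ⟨hatomic, fun x _ l =>
    (hf.partiallyWellOrderedOn_range.finite_multiset_card_sum x l).subset ?_⟩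
  rintro s ⟨⟨hs, hsum⟩, hcard⟩
  exact ⟨fun a ha => (hs a ha).mem_of_closure_eq hgen, hsum, hcard⟩
end

section
/- Every atomic positive monoid that is generated by the terms of a decreasing sequence of nonnegative real numbers is a length-finite factorization monoid (LFFM). -/
/-- A real number is, in only finitely many ways, the sum of `ℓ` terms of a decreasing sequence,
when every term is represented by its index under `Function.invFun f`. -/
theorem Antitone.finite_setOf_sum_eq {f : ℕ → ℝ} (hf : Antitone f) (x : ℝ) (ℓ : ℕ) :
    {n : Fin ℓ → ℕ | (∀ i, Function.invFun f (f (n i)) = n i) ∧ ∑ i, f (n i) = x}.Finite := by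
  refine WellQuasiOrderedLE.finite_of_isAntichain ?_
  rintro n ⟨hn, hnx⟩ m ⟨hm, hmx⟩ hne hle
  refine hne (funext fun i => ?_)
  have h := (Finset.sum_eq_sum_iff_of_le fun i _ => hf (hle i)).1 (hmx.trans hnx.symm) i
    (Finset.mem_univ i)
  rw [← hn i, ← hm i, h]

/-- A real number is the sum of only finitely many multisets of `ℓ` terms of a decreasing
sequence. -/
theorem Antitone.finite_setOf_multiset_sum_eq {f : ℕ → ℝ} (hf : Antitone f) (x : ℝ) (ℓ : ℕ) :
    {s : Multiset ℝ | (∀ a ∈ s, a ∈ Set.range f) ∧ s.sum = x ∧ Multiset.card s = ℓ}.Finite := by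
  refine ((hf.finite_setOf_sum_eq x ℓ).image
    fun n => (Finset.univ.val.map fun i => f (n i) : Multiset ℝ)).subset ?_
  rintro s ⟨hs, rfl, rfl⟩
  induction s using Quotient.inductionOn with | _ l =>
  have hl (i : Fin l.length) : f (Function.invFun f l[i]) = l[i] :=
    Function.invFun_eq (hs _ (List.getElem_mem i.2))
  have hmap : (Finset.univ.val.map fun i : Fin l.length => f (Function.invFun f l[i])) = l := by
    simp only [hl, Fin.univ_val_map]
    exact congrArg _ List.ofFn_getElem
  exact ⟨fun i => Function.invFun f l[i],
    ⟨fun i => congrArg _ (hl i), congrArg Multiset.sum hmap⟩, hmap⟩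

/-- Every atomic positive monoid generated by the terms of a decreasing sequence of
nonnegative real numbers is an LFFM. -/
theorem atomic_decreasing_positiveMonoid_isLFFM
    (f : ℕ → ℝ) (hdec : Antitone f) (hnonneg : ∀ n, 0 ≤ f n)
    (M : AddSubmonoid ℝ) (hgen : M = AddSubmonoid.closure (Set.range f))
    (hatomic : IsAddAtomic (M : Set ℝ)) :
    IsLFFM (M : Set ℝ) := by
  subst hgen
  refine ⟨hatomic, fun x _ ℓ => (hdec.finite_setOf_multiset_sum_eq x ℓ).subset ?_⟩
  rintro s ⟨⟨hs, hsum⟩, hcard⟩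
  exact ⟨fun a ha => (hs a ha).mem_of_closure, hsum, hcard⟩
end

section
/- A positive monoid M is a finite factorization monoid (FFM) if and only if it is both a bounded factorization monoid (BFM) and a length-finite factorization monoid (LFFM). -/
/-- `M` is a finite factorization monoid: it is atomic and every element has only
finitely many factorizations. -/
def IsFFM (M : Set ℝ) : Prop :=
  IsAddAtomic M ∧ ∀ x ∈ M, (AddFactorizations M x).Finite

/-- `M` is a bounded factorization monoid: it is atomic and every element has a
finite set of lengths of factorizations. -/
def IsBFM (M : Set ℝ) : Prop :=
  IsAddAtomic M ∧
    ∀ x ∈ M, {ℓ : ℕ | ∃ s ∈ AddFactorizations M x, Multiset.card s = ℓ}.Finite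

/-- A positive monoid is an FFM if and only if it is both a BFM and an LFFM. -/
theorem isFFM_iff_isBFM_and_isLFFM
    (M : AddSubmonoid ℝ) (hpos : ∀ x ∈ M, (0 : ℝ) ≤ x) :
    IsFFM (M : Set ℝ) ↔ IsBFM (M : Set ℝ) ∧ IsLFFM (M : Set ℝ) := by
  constructor
  · rintro ⟨hat, hfin⟩
    exact ⟨⟨hat, fun x hx => (hfin x hx).image Multiset.card⟩,
      ⟨hat, fun x hx ℓ => (hfin x hx).subset (Set.sep_subset _ _)⟩⟩
  · rintro ⟨⟨hat, hlen⟩, -, hfib⟩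
    exact ⟨hat, fun x hx => Set.Finite.of_finite_fibers Multiset.card (hlen x hx)
      fun ℓ _ => hfib x hx ℓ⟩
end

section
/- Let M be a positive monoid consisting of algebraic numbers, and let E(M) be the additive submonoid of ℝ generated by {e^m : m ∈ M} (which is a subsemiring of ℝ). If M satisfies the ascending chain condition on principal ideals (ACCP), then the multiplicative monoid of nonzero elements of E(M) satisfies the ACCP; that is, there is no element s ∈ E(M) together with sequences (s_n)_{n≥1} and (t_n)_{n≥1} of elements of E(M) \ {0, 1} such that s = t_n · s_1 · s_2 ⋯ s_n for every n ∈ ℕ. -/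
open Polynomial

theorem IsAlgebraic.exists_int_polynomial_eval_zero_ne_zero {K : Type*} [Field K] [CharZero K]
    (S : Finset K) (halg : ∀ x ∈ S, IsAlgebraic ℤ x) (h0 : ∀ x ∈ S, x ≠ 0) :
    ∃ f : ℤ[X], f.eval 0 ≠ 0 ∧ ∀ x ∈ S, aeval x f = 0 := by
  have key : ∀ x ∈ S, ∃ f : ℤ[X], f.coeff 0 ≠ 0 ∧ aeval x f = 0 := fun x hx ↦
    exists_nonzero_coeff_and_aeval_eq_zero (halg x hx) (mem_nonZeroDivisors_of_ne_zero (h0 x hx))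
  choose! f hf hfx using key
  refine ⟨∏ x ∈ S, f x, ?_, fun x hx ↦ ?_⟩
  · rw [eval_prod, Finset.prod_ne_zero_iff]
    intro x hx
    rw [← coeff_zero_eq_eval_zero]
    exact hf x hx
  · rw [map_prod]
    exact Finset.prod_eq_zero hx (hfx x hx)

theorem IsIntegral.pow_mul_aeval {R A : Type*} [CommRing R] [CommRing A] [Algebra R A]
    {a : R} {x : A} (hx : IsIntegral R (a • x)) (g : R[X]) {N : ℕ} (hN : g.natDegree ≤ N) :
    IsIntegral R (a ^ N • aeval x g) := by
  rw [aeval_eq_sum_range' (Nat.lt_succ_of_le hN), Finset.smul_sum]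
  refine IsIntegral.sum _ fun i hi ↦ ?_
  have hi' : i ≤ N := Nat.lt_succ_iff.1 (Finset.mem_range.1 hi)
  have : a ^ N • g.coeff i • x ^ i = (a ^ (N - i) * g.coeff i) • (a • x) ^ i := by
    rw [_root_.smul_pow, smul_smul, smul_smul]
    congr 1
    rw [mul_right_comm, ← pow_add, Nat.sub_add_cancel hi']
  rw [this]
  exact (hx.pow i).smul _

theorem IsIntegral.exists_intCast_eq_of_forall_fixed {K : Type*} [Field K] [Algebra ℚ K]
    [FiniteDimensional ℚ K] [IsGalois ℚ K] {x : K} (hx : IsIntegral ℤ x)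
    (hfix : ∀ σ : K ≃ₐ[ℚ] K, σ x = x) : ∃ m : ℤ, (m : K) = x := by
  obtain ⟨q, rfl⟩ := (IsGalois.mem_range_algebraMap_iff_fixed x).2 hfix
  have hq : IsIntegral ℤ q := (isIntegral_algebraMap_iff (algebraMap ℚ K).injective).1 hx
  obtain ⟨m, rfl⟩ := IsIntegrallyClosed.isIntegral_iff.1 hq
  exact ⟨m, by simp⟩

theorem exists_prime_gt_mul_pow_div_factorial_lt_one (C B c : ℝ) (N : ℕ) :
    ∃ p > N, p.Prime ∧ C * (B ^ p * (c ^ p / ((p - 1).factorial : ℝ))) < 1 := by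
  have h := (FloorSemiring.tendsto_pow_div_factorial_atTop (B * c)).const_mul (C * (B * c))
  rw [mul_zero] at h
  obtain ⟨M, hM⟩ := Filter.eventually_atTop.1 (h.eventually_lt_const one_pos)
  obtain ⟨p, hp, hprime⟩ := Nat.exists_infinite_primes (N + M + 1)
  refine ⟨p, by omega, hprime, ?_⟩
  obtain ⟨k, rfl⟩ : ∃ k, p = k + 1 := ⟨p - 1, by omega⟩
  refine lt_of_eq_of_lt ?_ (hM k (by omega))
  rw [Nat.add_sub_cancel, mul_pow, pow_succ, pow_succ]
  ring

theorem Complex.sum_mul_exp_ne_zero_of_invariant {K : Type*} [Field K] [Algebra ℚ K]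
    [FiniteDimensional ℚ K] [IsGalois ℚ K] (φ : K →+* ℂ) (w : K →₀ ℤ)
    (hinv : ∀ (σ : K ≃ₐ[ℚ] K) (x : K), w (σ x) = w x) (h0 : w 0 ≠ 0) :
    w.sum (fun x n ↦ (n : ℂ) * Complex.exp (φ x)) ≠ 0 := by
  classical
  intro hsum
  have : CharZero K := algebraRat.charZero K
  set T := w.support.erase 0 with hT
  have halg (x : K) : IsAlgebraic ℤ x :=
    (IsFractionRing.isAlgebraic_iff ℤ ℚ K).2 (Algebra.IsAlgebraic.isAlgebraic x)
  obtain ⟨f, hf0, hfT⟩ := IsAlgebraic.exists_int_polynomial_eval_zero_ne_zero T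
    (fun x _ ↦ halg x) (fun x hx ↦ Finset.ne_of_mem_erase hx)
  have hfne : f ≠ 0 := by rintro rfl; simp at hf0
  obtain ⟨c, hc⟩ := LindemannWeierstrass.exp_polynomial_approx f hf0
  set a := f.leadingCoeff
  have hane : a ≠ 0 := leadingCoeff_ne_zero.2 hfne
  set d := f.natDegree
  obtain ⟨p, hpN, hp, hlt⟩ := exists_prime_gt_mul_pow_div_factorial_lt_one
    (∑ x ∈ T, |(w x : ℝ)|) (|(a : ℝ)| ^ d) c ((f.eval 0).natAbs + a.natAbs + (w 0).natAbs)
  obtain ⟨n, hn, g, hgdeg, hg⟩ := hc p (by omega) hp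
  have hgdeg' : g.natDegree ≤ d * p := by rw [mul_comm d p]; omega
  obtain ⟨m, hm⟩ : ∃ m : ℤ, (m : K) = a ^ (d * p) • ∑ x ∈ T, w x • aeval x g := by
    refine IsIntegral.exists_intCast_eq_of_forall_fixed ?_ fun σ ↦ ?_
    · rw [Finset.smul_sum]
      refine IsIntegral.sum _ fun x hx ↦ ?_
      rw [smul_comm]
      refine IsIntegral.smul _ (IsIntegral.pow_mul_aeval ?_ g hgdeg')
      exact isIntegral_leadingCoeff_smul f x (hfT x hx)
    · rw [map_zsmul, map_sum]
      congr 1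
      refine Finset.sum_equiv σ.toEquiv (fun x ↦ ?_) fun x _ ↦ ?_
      · simp [hT, hinv]
      · rw [map_zsmul, AlgEquiv.toEquiv_eq_coe, EquivLike.coe_coe, hinv]
        congr 1
        exact (aeval_algHom_apply (σ.toAlgHom.restrictScalars ℤ) x g).symm
  have hpdvd (z : ℤ) (hz : z ≠ 0) (hzp : z.natAbs < p) : ¬ (p : ℤ) ∣ z := fun h ↦
    absurd (Nat.le_of_dvd (Int.natAbs_pos.2 hz) (Int.natCast_dvd.1 h)) (by omega)
  have hpZ : Prime (p : ℤ) := Nat.prime_iff_prime_int.1 hp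
  have hz : a ^ (d * p) * (n * w 0) + p * m ≠ 0 := by
    intro h
    have h1 : (p : ℤ) ∣ a ^ (d * p) * (n * w 0) :=
      (dvd_add_left (dvd_mul_right _ m)).1 (h ▸ dvd_zero _)
    rcases hpZ.dvd_or_dvd h1 with h2 | h2
    · exact hpdvd a hane (by omega) (hpZ.dvd_of_dvd_pow h2)
    · rcases hpZ.dvd_or_dvd h2 with h3 | h3
      · exact hn h3
      · exact hpdvd _ h0 (by omega) h3
  have hmC : (m : ℂ) = a ^ (d * p) * ∑ x ∈ T, w x * aeval (φ x) g := by
    have := congrArg φ hm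
    rw [map_intCast, map_zsmul, map_sum] at this
    rw [this, zsmul_eq_mul]
    push_cast
    congr 1
    refine Finset.sum_congr rfl fun x _ ↦ ?_
    rw [map_zsmul, zsmul_eq_mul]
    congr 1
    exact (aeval_algHom_apply φ.toIntAlgHom x g).symm
  have hsum' : (w 0 : ℂ) + ∑ x ∈ T, w x * Complex.exp (φ x) = 0 := by
    rw [← hsum, Finsupp.sum, ← Finset.add_sum_erase _ _ (Finsupp.mem_support_iff.2 h0)]
    simp [hT]
  have hzC : ((a ^ (d * p) * (n * w 0) + p * m : ℤ) : ℂ) =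
      - (a ^ (d * p) * ∑ x ∈ T, w x * (n • Complex.exp (φ x) - p • aeval (φ x) g)) := by
    push_cast
    simp only [mul_sub, zsmul_eq_mul, nsmul_eq_mul, Finset.sum_sub_distrib, mul_left_comm (w _ : ℂ)]
    rw [← Finset.mul_sum, ← Finset.mul_sum, hmC]
    linear_combination (a : ℂ) ^ (d * p) * n * hsum'
  have hge : (1 : ℝ) ≤ ‖((a ^ (d * p) * (n * w 0) + p * m : ℤ) : ℂ)‖ := by
    rw [Complex.norm_intCast]
    exact_mod_cast Int.one_le_abs hz
  have hroot (x) (hx : x ∈ T) : φ x ∈ f.aroots ℂ := by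
    rw [mem_aroots]
    refine ⟨hfne, ?_⟩
    have := aeval_algHom_apply φ.toIntAlgHom x f
    rw [hfT x hx, map_zero] at this
    exact this
  refine absurd hge (not_le.2 (lt_of_le_of_lt ?_ hlt))
  rw [hzC, norm_neg, norm_mul, norm_pow, Complex.norm_intCast, pow_mul, mul_left_comm,
    Finset.sum_mul]
  refine mul_le_mul_of_nonneg_left ((norm_sum_le _ _).trans (Finset.sum_le_sum fun x hx ↦ ?_))
    (by positivity)
  rw [norm_mul, Complex.norm_intCast]
  exact mul_le_mul_of_nonneg_left (hg (hroot x hx)) (abs_nonneg _)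

/-- The ring homomorphism `ℤ[K] → ℂ` sending the basis element of `x` to `exp (φ x)`. -/
noncomputable def Complex.expLift {K : Type*} [Field K] (φ : K →+* ℂ) :
    AddMonoidAlgebra ℤ K →ₐ[ℤ] ℂ :=
  AddMonoidAlgebra.lift ℤ ℂ K
    (Complex.expMonoidHom.comp (AddMonoidHom.toMultiplicative φ.toAddMonoidHom))

theorem Complex.expLift_apply {K : Type*} [Field K] (φ : K →+* ℂ) (F : AddMonoidAlgebra ℤ K) :
    Complex.expLift φ F = F.coeff.sum (fun x n ↦ (n : ℂ) * Complex.exp (φ x)) := by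
  rw [expLift, AddMonoidAlgebra.lift_apply']
  rfl

theorem Complex.expLift_ne_zero {K : Type*} [Field K] [Algebra ℚ K]
    [FiniteDimensional ℚ K] [IsGalois ℚ K] (φ : K →+* ℂ) {F : AddMonoidAlgebra ℤ K}
    (hF : F ≠ 0) : Complex.expLift φ F ≠ 0 := by
  classical
  intro hzero
  let act (σ : K ≃ₐ[ℚ] K) : AddMonoidAlgebra ℤ K →+* AddMonoidAlgebra ℤ K :=
    AddMonoidAlgebra.mapDomainRingHom ℤ (σ : K →+ K)
  have act_coeff (σ : K ≃ₐ[ℚ] K) (G : AddMonoidAlgebra ℤ K) (x : K) :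
      (act σ G).coeff (σ x) = G.coeff x :=
    Finsupp.mapDomain_apply σ.injective _ _
  have act_act (σ τ : K ≃ₐ[ℚ] K) (G : AddMonoidAlgebra ℤ K) : act σ (act τ G) = act (σ * τ) G := by
    ext x
    obtain ⟨y, rfl⟩ := (σ * τ).surjective x
    rw [act_coeff, AlgEquiv.mul_apply, act_coeff, act_coeff]
  let P := ∏ σ : K ≃ₐ[ℚ] K, act σ F
  have hP_inv (σ : K ≃ₐ[ℚ] K) : act σ P = P := by
    simp only [P, map_prod, act_act]
    exact Fintype.prod_equiv (Equiv.mulLeft σ) _ _ fun τ ↦ rfl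
  have hP : P ≠ 0 := by
    refine Finset.prod_ne_zero_iff.2 fun σ _ h ↦ hF ?_
    ext x
    rw [← act_coeff σ, h]
    rfl
  have hP_eval : Complex.expLift φ P = 0 := by
    rw [map_prod]
    refine Finset.prod_eq_zero (Finset.mem_univ 1) ?_
    convert hzero
    ext x
    exact act_coeff 1 F x
  obtain ⟨β, hβ⟩ : ∃ β, P.coeff β ≠ 0 := by
    by_contra! h
    exact hP (AddMonoidAlgebra.ext (Finsupp.ext h))
  let Q := P * ∑ τ : K ≃ₐ[ℚ] K, AddMonoidAlgebra.single (-τ β) (1 : ℤ)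
  have hQ_inv (σ : K ≃ₐ[ℚ] K) : act σ Q = Q := by
    simp only [Q, map_mul, hP_inv, map_sum]
    congr 1
    refine Fintype.sum_equiv (Equiv.mulLeft σ) _ _ fun τ ↦ ?_
    simp [act]
  have hQ0 : Q.coeff 0 = Fintype.card (K ≃ₐ[ℚ] K) * P.coeff β := by
    have (τ : K ≃ₐ[ℚ] K) : P.coeff (τ β) = P.coeff β := by
      conv_lhs => rw [← hP_inv τ, act_coeff]
    simp [Q, Finset.mul_sum, this]
  refine Complex.sum_mul_exp_ne_zero_of_invariant φ Q.coeff (fun σ x ↦ ?_) ?_ ?_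
  · conv_lhs => rw [← hQ_inv σ, act_coeff]
  · rw [hQ0]
    exact mul_ne_zero (by simp) hβ
  · rw [← Complex.expLift_apply, map_mul, hP_eval, zero_mul]

/-- The **Lindemann–Weierstrass theorem**: the exponentials of distinct algebraic numbers are
linearly independent over the integers. -/
theorem Complex.eq_zero_of_sum_mul_exp_eq_zero (S : Finset ℂ)
    (hS : ∀ x ∈ S, IsAlgebraic ℚ x) (w : ℂ → ℤ)
    (hw : ∑ x ∈ S, (w x : ℂ) * Complex.exp x = 0) : ∀ x ∈ S, w x = 0 := by
  classical
  let q : ℚ[X] := ∏ x ∈ S, minpoly ℚ x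
  have hq : q ≠ 0 := Finset.prod_ne_zero_iff.2 fun x hx ↦ minpoly.ne_zero (hS x hx).isIntegral
  let K := IntermediateField.adjoin ℚ (q.rootSet ℂ)
  have hsplit : q.IsSplittingField ℚ K :=
    IntermediateField.adjoin_rootSet_isSplittingField (IsAlgClosed.splits _)
  have : FiniteDimensional ℚ K := IsSplittingField.finiteDimensional K q
  have : Normal ℚ K := Normal.of_isSplittingField q
  have : IsGalois ℚ K := ⟨⟩
  have hSK (x) (hx : x ∈ S) : x ∈ K := by
    refine IntermediateField.subset_adjoin ℚ _ ((mem_rootSet_of_ne hq).2 ?_)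
    rw [map_prod]
    exact Finset.prod_eq_zero hx (minpoly.aeval ℚ x)
  let F : AddMonoidAlgebra ℤ K :=
    ∑ x : S, AddMonoidAlgebra.single (⟨x, hSK x x.2⟩ : K) (w x)
  have hF : F = 0 := by
    by_contra hF
    refine Complex.expLift_ne_zero K.val.toRingHom hF ?_
    rw [map_sum, ← hw, ← Finset.sum_coe_sort S]
    refine Finset.sum_congr rfl fun x _ ↦ ?_
    rw [Complex.expLift_apply]
    simp
  intro x hx
  have h := congrArg (fun G ↦ G.coeff ⟨x, hSK x hx⟩) hF
  simp only [F, AddMonoidAlgebra.coeff_sum, AddMonoidAlgebra.coeff_single, Finsupp.finsetSum_apply,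
    Finsupp.single_apply, Subtype.mk.injEq] at h
  rw [Finset.sum_eq_single (⟨x, hx⟩ : S) (by aesop) (by simp)] at h
  simpa using h

theorem Real.eq_zero_of_sum_mul_exp_eq_zero (S : Finset ℝ)
    (hS : ∀ x ∈ S, IsAlgebraic ℚ x) (w : ℝ → ℤ)
    (hw : ∑ x ∈ S, (w x : ℝ) * Real.exp x = 0) : ∀ x ∈ S, w x = 0 := by
  intro x hx
  have := Complex.eq_zero_of_sum_mul_exp_eq_zero (S.map ⟨_, Complex.ofReal_injective⟩)
    (fun z hz ↦ ?_) (fun z ↦ w z.re) ?_ x (by simpa using hx)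
  · simpa using this
  · obtain ⟨y, hy, rfl⟩ := Finset.mem_map.1 hz
    exact (hS y hy).algebraMap
  · simpa using congrArg Complex.ofReal hw

theorem Real.multiset_eq_of_sum_exp_eq {A B : Multiset ℝ} (hA : ∀ x ∈ A, IsAlgebraic ℚ x)
    (hB : ∀ x ∈ B, IsAlgebraic ℚ x) (h : (A.map Real.exp).sum = (B.map Real.exp).sum) :
    A = B := by
  classical
  have key (C : Multiset ℝ) (hC : C ≤ A + B) :
      (C.map Real.exp).sum = ∑ x ∈ (A + B).toFinset, (C.count x : ℝ) * Real.exp x := by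
    rw [Finset.sum_multiset_map_count]
    simp only [nsmul_eq_mul]
    refine Finset.sum_subset (Multiset.toFinset_subset.2 (Multiset.subset_of_le hC))
      fun x _ hx ↦ ?_
    simp_all
  have hw := Real.eq_zero_of_sum_mul_exp_eq_zero (A + B).toFinset
    (fun x hx ↦ (Multiset.mem_add.1 (Multiset.mem_toFinset.1 hx)).elim (hA x) (hB x))
    (fun x ↦ A.count x - B.count x) (by
      push_cast
      simp only [sub_mul, Finset.sum_sub_distrib]
      rw [← key A (Multiset.le_add_right _ _), ← key B (Multiset.le_add_left _ _), h, sub_self])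
  ext x
  by_cases hx : x ∈ A + B
  · exact_mod_cast sub_eq_zero.1 (hw x (Multiset.mem_toFinset.2 hx))
  · rw [Multiset.mem_add, not_or] at hx
    rw [Multiset.count_eq_zero_of_notMem hx.1, Multiset.count_eq_zero_of_notMem hx.2]

theorem AddSubmonoid.exists_multiset_of_mem_closure_exp {M : AddSubmonoid ℝ} {s : ℝ}
    (hs : s ∈ AddSubmonoid.closure (Real.exp '' (M : Set ℝ))) :
    ∃ B : Multiset ℝ, (∀ x ∈ B, x ∈ M) ∧ (B.map Real.exp).sum = s := by
  induction hs using AddSubmonoid.closure_induction with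
  | mem x hx =>
    obtain ⟨m, hm, rfl⟩ := hx
    exact ⟨{m}, by simpa using hm, by simp⟩
  | zero => exact ⟨0, by simp, by simp⟩
  | add x y _ _ hx hy =>
    obtain ⟨A, hA, rfl⟩ := hx
    obtain ⟨B, hB, rfl⟩ := hy
    exact ⟨A + B, fun x hx ↦ (Multiset.mem_add.1 hx).elim (hA x) (hB x), by simp⟩

theorem AddSubmonoid.mul_mem_closure_exp {M : AddSubmonoid ℝ} {s t : ℝ}
    (hs : s ∈ AddSubmonoid.closure (Real.exp '' (M : Set ℝ)))
    (ht : t ∈ AddSubmonoid.closure (Real.exp '' (M : Set ℝ))) :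
    s * t ∈ AddSubmonoid.closure (Real.exp '' (M : Set ℝ)) := by
  have h := AddSubmonoid.mul_mem_mul hs ht
  rw [AddSubmonoid.closure_mul_closure] at h
  refine AddSubmonoid.closure_mono ?_ h
  rintro _ ⟨_, ⟨a, ha, rfl⟩, _, ⟨b, hb, rfl⟩, rfl⟩
  exact ⟨a + b, M.add_mem ha hb, Real.exp_add a b⟩

theorem AddSubmonoid.one_mem_closure_exp (M : AddSubmonoid ℝ) :
    (1 : ℝ) ∈ AddSubmonoid.closure (Real.exp '' (M : Set ℝ)) :=
  AddSubmonoid.subset_closure ⟨0, M.zero_mem, Real.exp_zero⟩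

theorem AddSubmonoid.prod_mem_closure_exp {ι : Type*} {M : AddSubmonoid ℝ} (I : Finset ι)
    {f : ι → ℝ} (hf : ∀ i ∈ I, f i ∈ AddSubmonoid.closure (Real.exp '' (M : Set ℝ))) :
    ∏ i ∈ I, f i ∈ AddSubmonoid.closure (Real.exp '' (M : Set ℝ)) :=
  Finset.prod_induction f (· ∈ AddSubmonoid.closure (Real.exp '' (M : Set ℝ)))
    (fun _ _ ↦ AddSubmonoid.mul_mem_closure_exp) (AddSubmonoid.one_mem_closure_exp M) hf

theorem AddSubmonoid.eq_exp_or_two_le_of_mem_closure_exp {M : AddSubmonoid ℝ}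
    (hpos : ∀ x ∈ M, (0 : ℝ) ≤ x) {s : ℝ}
    (hs : s ∈ AddSubmonoid.closure (Real.exp '' (M : Set ℝ))) (h0 : s ≠ 0) :
    (∃ x ∈ M, s = Real.exp x) ∨ 2 ≤ s := by
  obtain ⟨B, hB, rfl⟩ := AddSubmonoid.exists_multiset_of_mem_closure_exp hs
  have hcard : (B.card : ℝ) ≤ (B.map Real.exp).sum := by
    have := Multiset.card_nsmul_le_sum (s := B.map Real.exp) (a := 1) (by
      simpa using fun x hx ↦ hpos x (hB x hx))
    simpa using this
  have hcard0 : B.card ≠ 0 := fun h ↦ h0 (by simp [Multiset.card_eq_zero.1 h])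
  obtain h1 | h2 : B.card = 1 ∨ 2 ≤ B.card := by omega
  · obtain ⟨x, rfl⟩ := Multiset.card_eq_one.1 h1
    exact .inl ⟨x, hB x (by simp), by simp⟩
  · exact .inr (le_trans (by exact_mod_cast h2) hcard)

theorem Finset.pow_card_le_prod_range {f : ℕ → ℝ} {c : ℝ} (hc : 0 ≤ c) (hf : ∀ i, 1 ≤ f i)
    {A : Finset ℕ} (hA : ∀ i ∈ A, c ≤ f i) {n : ℕ} (hn : A ⊆ Finset.range n) :
    c ^ A.card ≤ ∏ i ∈ Finset.range n, f i := by
  calc c ^ A.card = ∏ _i ∈ A, c := by simp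
    _ ≤ ∏ i ∈ A, f i := Finset.prod_le_prod (fun _ _ ↦ hc) hA
    _ ≤ ∏ i ∈ Finset.range n, f i :=
      Finset.prod_le_prod_of_subset_of_one_le hn
        (fun i _ ↦ zero_le_one.trans (hf i)) fun i _ _ ↦ hf i

/-- Let `M` be a positive monoid consisting of algebraic numbers and let
`E(M)` be the additive submonoid of `ℝ` generated by `{e^m : m ∈ M}`.
If `M` satisfies the ACCP, then the multiplicative monoid of nonzero elements of
`E(M)` satisfies the ACCP: there is no `s ∈ E(M)` together with sequences
`(s_n)` and `(t_n)` of elements of `E(M) \ {0, 1}` such that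
`s = t_n * s_1 * ⋯ * s_n` for every `n`. -/
theorem accp_ascends_to_exponentiation_semiring
    (M : AddSubmonoid ℝ) (hpos : ∀ x ∈ M, (0 : ℝ) ≤ x)
    (halg : ∀ x ∈ M, IsAlgebraic ℚ x)
    (hACCP : ¬ ∃ b ∈ M, ∃ c : ℕ → ℝ, (∀ n, c n ∈ M ∧ c n ≠ 0) ∧
      ∀ n : ℕ, ∃ d ∈ M, b = (∑ i ∈ Finset.range n, c i) + d) :
    ¬ ∃ s ∈ AddSubmonoid.closure (Real.exp '' (M : Set ℝ)),
      ∃ sseq tseq : ℕ → ℝ,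
        (∀ n, sseq n ∈ AddSubmonoid.closure (Real.exp '' (M : Set ℝ)) ∧
          sseq n ≠ 0 ∧ sseq n ≠ 1) ∧
        (∀ n, tseq n ∈ AddSubmonoid.closure (Real.exp '' (M : Set ℝ)) ∧
          tseq n ≠ 0 ∧ tseq n ≠ 1) ∧
        ∀ n : ℕ, s = tseq n * ∏ i ∈ Finset.range n, sseq i := by
  rintro ⟨s, hs, u, t, hu, ht, hst⟩
  have one_le {x : ℝ} (hx : x ∈ AddSubmonoid.closure (Real.exp '' (M : Set ℝ))) (h0 : x ≠ 0) :
      1 ≤ x := by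
    rcases AddSubmonoid.eq_exp_or_two_le_of_mem_closure_exp hpos hx h0 with ⟨m, hm, rfl⟩ | h
    · exact Real.one_le_exp (hpos m hm)
    · linarith
  have hfin : {i | 2 ≤ u i}.Finite := by
    by_contra hinf
    obtain ⟨k, hk⟩ := pow_unbounded_of_one_lt s one_lt_two
    obtain ⟨A, hA, rfl⟩ := Set.Infinite.exists_subset_card_eq hinf k
    obtain ⟨n, hn⟩ := A.exists_nat_subset_range
    have h := Finset.pow_card_le_prod_range zero_le_two (fun i ↦ one_le (hu i).1 (hu i).2.1) hA hn
    have ht1 : 1 ≤ t n := one_le (ht n).1 (ht n).2.1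
    have := hst n
    nlinarith [pow_pos (zero_lt_two (α := ℝ)) A.card]
  obtain ⟨N, hN⟩ := hfin.bddAbove
  have hexp (n : ℕ) : ∃ x ∈ M, u (N + 1 + n) = Real.exp x :=
    (AddSubmonoid.eq_exp_or_two_le_of_mem_closure_exp hpos (hu _).1 (hu _).2.1).resolve_right
      fun h ↦ absurd (hN h) (by omega)
  choose c hcM hc using hexp
  obtain ⟨B, hB, rfl⟩ := AddSubmonoid.exists_multiset_of_mem_closure_exp hs
  obtain ⟨b, hb⟩ : ∃ b, b ∈ B := by
    refine Multiset.exists_mem_of_ne_zero ?_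
    rintro rfl
    exact (ht 0).2.1 (by simpa using (hst 0).symm)
  refine hACCP ⟨b, hB b hb, c, fun n ↦ ⟨hcM n, fun h0 ↦ (hu (N + 1 + n)).2.2 ?_⟩, fun n ↦ ?_⟩
  · rw [hc, h0, Real.exp_zero]
  have hcofactor := AddSubmonoid.mul_mem_closure_exp (ht (N + 1 + n)).1
    (AddSubmonoid.prod_mem_closure_exp (Finset.range (N + 1)) fun i _ ↦ (hu i).1)
  obtain ⟨D, hD, hDsum⟩ := AddSubmonoid.exists_multiset_of_mem_closure_exp hcofactor
  have hBD : B = D.map (∑ i ∈ Finset.range n, c i + ·) := by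
    have hsumM : ∑ i ∈ Finset.range n, c i ∈ M := sum_mem fun i _ ↦ hcM i
    refine Real.multiset_eq_of_sum_exp_eq (fun x hx ↦ halg x (hB x hx)) (fun x hx ↦ ?_) ?_
    · obtain ⟨d, hd, rfl⟩ := Multiset.mem_map.1 hx
      exact halg _ (M.add_mem hsumM (hD d hd))
    · rw [Multiset.map_map]
      simp only [Function.comp_def, Real.exp_add, Multiset.sum_map_mul_left]
      rw [hDsum, Real.exp_sum, hst (N + 1 + n), Finset.prod_range_add]
      simp only [hc]
      ring
  rw [hBD] at hb
  obtain ⟨d, hd, rfl⟩ := Multiset.mem_map.1 hb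
  exact ⟨d, hD d hd, rfl⟩
end

section
/- Let M be a positive monoid consisting of algebraic numbers, and let E(M) be the additive submonoid of ℝ generated by {e^m : m ∈ M} (which is a subsemiring of ℝ). If M is a finite factorization monoid (FFM), then E(M) is a finite factorization semiring; that is, the multiplicative monoid of nonzero elements of E(M) is atomic and every nonzero q ∈ E(M) has only finitely many multiplicative factorizations into multiplicative atoms of E(M). -/
/-- `a` is a multiplicative atom of the set `S ⊆ ℝ` (whose only unit is `1`). -/
def IsMulAtom (S : Set ℝ) (a : ℝ) : Prop :=
  a ∈ S ∧ a ≠ 0 ∧ a ≠ 1 ∧ ∀ b ∈ S, ∀ c ∈ S, a = b * c → b = 1 ∨ c = 1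

/-- The multiplicative factorizations of `q` in `S`: multisets of multiplicative
atoms of `S` whose product is `q`. -/
def MulFactorizations (S : Set ℝ) (q : ℝ) : Set (Multiset ℝ) :=
  {s | (∀ a ∈ s, IsMulAtom S a) ∧ s.prod = q}

open Polynomial in
theorem isIntegral_pow_mul_aeval {K : Type*} [Field K] {k : ℤ} {x : K}
    (hx : IsIntegral ℤ (k • x)) (g : ℤ[X]) {N : ℕ} (hg : g.natDegree ≤ N) :
    IsIntegral ℤ ((k : K) ^ N * aeval x g) := by
  rw [aeval_eq_sum_range, Finset.mul_sum]
  refine IsIntegral.sum _ fun i hi => ?_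
  have hi' : i ≤ N := (Nat.lt_succ_iff.mp (Finset.mem_range.mp hi)).trans hg
  have : (k : K) ^ N * (g.coeff i • x ^ i) = (g.coeff i * k ^ (N - i) : ℤ) • (k • x) ^ i := by
    obtain ⟨j, rfl⟩ := Nat.exists_eq_add_of_le hi'
    simp only [zsmul_eq_mul, Nat.add_sub_cancel_left]
    push_cast
    ring
  rw [this]
  exact (hx.pow i).smul _

theorem exists_int_eq_of_isIntegral_of_fixed {K : Type*} [Field K] [NumberField K] [IsGalois ℚ K]
    {x : K} (hx : IsIntegral ℤ x) (hfix : ∀ σ : K ≃ₐ[ℚ] K, σ x = x) : ∃ m : ℤ, (m : K) = x := by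
  obtain ⟨r, rfl⟩ := IntermediateField.mem_bot.mp ((IsGalois.mem_bot_iff_fixed x).mpr hfix)
  rw [isIntegral_algebraMap_iff (algebraMap ℚ K).injective] at hx
  obtain ⟨m, rfl⟩ := IsIntegrallyClosed.isIntegral_iff.mp hx
  exact ⟨m, by simp⟩

theorem tendsto_mul_pow_div_factorial_pred (A B : ℝ) :
    Filter.Tendsto (fun p : ℕ => A * (B ^ p / (p - 1).factorial)) Filter.atTop (nhds 0) := by
  rw [← Filter.tendsto_add_atTop_iff_nat 1]
  have := (FloorSemiring.tendsto_pow_div_factorial_atTop B).const_mul (A * B)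
  rw [mul_zero] at this
  refine this.congr fun n => ?_
  rw [Nat.add_sub_cancel]
  ring

open Polynomial in
theorem exists_int_polynomial_common_root {K : Type*} [Field K] [NumberField K] (S : Finset K)
    (hS : (0 : K) ∉ S) : ∃ f : ℤ[X], f.eval 0 ≠ 0 ∧ ∀ x ∈ S, aeval x f = 0 := by
  have h (x : K) : ∃ q : ℤ[X], x ≠ 0 → q.coeff 0 ≠ 0 ∧ aeval x q = 0 := by
    by_cases hx : x = 0
    · exact ⟨0, fun h => (h hx).elim⟩
    · have halg : IsAlgebraic ℤ x := (IsFractionRing.isAlgebraic_iff ℤ ℚ K).mpr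
        (Algebra.IsAlgebraic.isAlgebraic x)
      obtain ⟨q, hq⟩ := halg.exists_nonzero_coeff_and_aeval_eq_zero
        (mem_nonZeroDivisors_of_ne_zero hx)
      exact ⟨q, fun _ => hq⟩
  choose q hq using h
  have hne : ∀ x ∈ S, x ≠ 0 := fun x hx h => hS (h ▸ hx)
  refine ⟨∏ x ∈ S, q x, ?_, fun x hx => ?_⟩
  · rw [eval_prod, Finset.prod_ne_zero_iff]
    intro x hx
    rw [← coeff_zero_eq_eval_zero]
    exact (hq x (hne x hx)).1
  · rw [map_prod]
    exact Finset.prod_eq_zero hx (hq x (hne x hx)).2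

open Polynomial in
theorem sum_mul_exp_ne_zero_of_galois_invariant {K : Type*} [Field K] [NumberField K]
    [IsGalois ℚ K] (φ : K →+* ℂ) (F : K →₀ ℤ) (h0 : F 0 ≠ 0)
    (hinv : ∀ σ : K ≃ₐ[ℚ] K, ∀ x, F (σ x) = F x) :
    F.sum (fun x a => (a : ℂ) * Complex.exp (φ x)) ≠ 0 := by
  classical
  intro hsum
  set S := F.support.erase 0 with hS
  obtain ⟨f, hf0, hfS⟩ := exists_int_polynomial_common_root S (Finset.notMem_erase 0 _)
  obtain ⟨k, hk, hkS⟩ := exists_integral_multiples ℤ ℚ S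
  obtain ⟨c, hc⟩ := LindemannWeierstrass.exp_polynomial_approx f hf0
  set d := f.natDegree with hd
  have hf_ne : f ≠ 0 := by rintro rfl; simp at hf0
  have hroot : ∀ x ∈ S, φ x ∈ f.aroots ℂ := fun x hx => by
    rw [mem_aroots]
    refine ⟨hf_ne, ?_⟩
    have : aeval (φ.toIntAlgHom x) f = φ.toIntAlgHom (aeval x f) := aeval_algHom_apply _ _ _
    rw [hfS x hx, map_zero] at this
    exact this
  have hsum' : (F 0 : ℂ) + ∑ x ∈ S, (F x : ℂ) * Complex.exp (φ x) = 0 := by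
    rw [← hsum, Finsupp.sum, ← Finset.add_sum_erase _ _ (Finsupp.mem_support_iff.mpr h0)]
    simp [hS]
  set A : ℝ := ∑ x ∈ S, |(F x : ℝ)| with hA
  have hev := (tendsto_mul_pow_div_factorial_pred A (|(k : ℝ)| ^ d * c)).eventually
    (gt_mem_nhds zero_lt_one)
  obtain ⟨N, hN⟩ := Filter.eventually_atTop.mp hev
  obtain ⟨p, hpN, hp⟩ := Nat.exists_infinite_primes
    (N + (eval 0 f).natAbs + k.natAbs + (F 0).natAbs + 1)
  obtain ⟨n, hpn, g, hgdeg, hg⟩ := hc p (by omega) hp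
  have hsmall := hN p (by omega)
  obtain ⟨m, hm⟩ : ∃ m : ℤ, (m : K) = ∑ x ∈ S, F x • ((k : K) ^ (p * d) * aeval x g) := by
    refine exists_int_eq_of_isIntegral_of_fixed ?_ fun σ => ?_
    · refine IsIntegral.sum _ fun x hx => IsIntegral.smul _ ?_
      exact isIntegral_pow_mul_aeval (hkS x hx) g (hgdeg.trans (Nat.sub_le _ _))
    · rw [map_sum]
      refine Finset.sum_equiv σ.toEquiv (fun x => ?_) fun x hx => ?_
      · simp [hS, hinv]
      · have : aeval (σ x) g = σ (aeval x g) :=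
          aeval_algHom_apply ((σ : K →+* K).toIntAlgHom) x g
        simp [this, hinv]
  have hmC : (m : ℂ) = ∑ x ∈ S, (F x : ℂ) * ((k : ℂ) ^ (p * d) * aeval (φ x) g) := by
    have := congrArg φ hm
    rw [map_intCast, map_sum] at this
    rw [this]
    refine Finset.sum_congr rfl fun x _ => ?_
    have : aeval (φ x) g = φ (aeval x g) := aeval_algHom_apply φ.toIntAlgHom x g
    simp [this]
  have hkey : ((k ^ (p * d) * (n * F 0) + p * m : ℤ) : ℂ) =
      -((k : ℂ) ^ (p * d) *
        ∑ x ∈ S, (F x : ℂ) * (n • Complex.exp (φ x) - p • aeval (φ x) g)) := by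
    have e1 : (F 0 : ℂ) = -∑ x ∈ S, (F x : ℂ) * Complex.exp (φ x) :=
      eq_neg_of_add_eq_zero_left hsum'
    push_cast
    rw [e1, hmC]
    simp only [zsmul_eq_mul, nsmul_eq_mul, mul_neg, Finset.mul_sum, ← Finset.sum_neg_distrib,
      ← Finset.sum_add_distrib]
    refine Finset.sum_congr rfl fun x _ => ?_
    ring
  have hlt : ‖((k ^ (p * d) * (n * F 0) + p * m : ℤ) : ℂ)‖ < 1 := by
    rw [hkey, norm_neg, norm_mul, norm_pow, Complex.norm_intCast]
    calc |(k : ℝ)| ^ (p * d) *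
          ‖∑ x ∈ S, (F x : ℂ) * (n • Complex.exp (φ x) - p • aeval (φ x) g)‖
        ≤ |(k : ℝ)| ^ (p * d) * ∑ x ∈ S, |(F x : ℝ)| * (c ^ p / (p - 1).factorial) := by
          gcongr
          refine norm_sum_le_of_le _ fun x hx => ?_
          rw [norm_mul, Complex.norm_intCast]
          gcongr
          exact hg (hroot x hx)
      _ = A * ((|(k : ℝ)| ^ d * c) ^ p / (p - 1).factorial) := by
          rw [← Finset.sum_mul, mul_pow, ← pow_mul, mul_comm d p]
          ring
      _ < 1 := hsmall
  have hzero : k ^ (p * d) * (n * F 0) + p * m = 0 := by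
    rw [Complex.norm_intCast] at hlt
    exact Int.abs_lt_one_iff.mp (by exact_mod_cast hlt)
  have hdvd : (p : ℤ) ∣ k ^ (p * d) * (n * F 0) :=
    ⟨-m, by linear_combination hzero⟩
  have hpZ := Nat.prime_iff_prime_int.mp hp
  have hsmall_not_dvd (z : ℤ) (hz : z ≠ 0) (hzp : z.natAbs < p) : ¬ (p : ℤ) ∣ z := fun h =>
    absurd (Nat.le_of_dvd (Int.natAbs_pos.mpr hz) (Int.natCast_dvd.mp h)) (by omega)
  rcases hpZ.dvd_or_dvd hdvd with h | h
  · exact hsmall_not_dvd k hk (by omega) (hpZ.dvd_of_dvd_pow h)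
  · rcases hpZ.dvd_or_dvd h with h | h
    · exact hpn h
    · exact hsmall_not_dvd _ h0 (by omega) h

/-- Evaluation of a formal integer combination of exponents `x : K` at the complex numbers
`exp (φ x)`. -/
noncomputable def expEval {K : Type*} [Field K] (φ : K →+* ℂ) : AddMonoidAlgebra ℤ K →ₐ[ℤ] ℂ :=
  AddMonoidAlgebra.lift ℤ ℂ K
    { toFun := fun x => Complex.exp (φ x.toAdd)
      map_one' := by simp
      map_mul' := fun x y => by simp [Complex.exp_add] }

theorem expEval_apply {K : Type*} [Field K] (φ : K →+* ℂ) (F : AddMonoidAlgebra ℤ K) :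
    expEval φ F = F.coeff.sum fun x a => (a : ℂ) * Complex.exp (φ x) := by
  simp [expEval, AddMonoidAlgebra.lift_apply]

/-- The action of a field automorphism on the exponents. -/
noncomputable def galMap {K : Type*} [Field K] [Algebra ℚ K] (σ : K ≃ₐ[ℚ] K) :
    AddMonoidAlgebra ℤ K →+* AddMonoidAlgebra ℤ K :=
  AddMonoidAlgebra.mapDomainRingHom ℤ (σ : K →+ K)

section

variable {K : Type*} [Field K] [Algebra ℚ K]

theorem coeff_galMap (σ : K ≃ₐ[ℚ] K) (F : AddMonoidAlgebra ℤ K) (x : K) :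
    (galMap σ F).coeff (σ x) = F.coeff x := by
  change (AddMonoidAlgebra.mapDomain σ F).coeff (σ x) = _
  rw [AddMonoidAlgebra.coeff_mapDomain, Finsupp.mapDomain_apply σ.injective]

theorem galMap_injective (σ : K ≃ₐ[ℚ] K) : Function.Injective (galMap σ) :=
  AddMonoidAlgebra.mapDomain_injective σ.injective

theorem galMap_single (σ : K ≃ₐ[ℚ] K) (x : K) (a : ℤ) :
    galMap σ (AddMonoidAlgebra.single x a) = AddMonoidAlgebra.single (σ x) a :=
  AddMonoidAlgebra.mapDomain_single

theorem galMap_mul (σ τ : K ≃ₐ[ℚ] K) (F : AddMonoidAlgebra ℤ K) :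
    galMap (σ * τ) F = galMap σ (galMap τ F) :=
  congrArg (fun f => f F)
    (AddMonoidAlgebra.mapDomainRingHom_comp (R := ℤ) (σ : K →+ K) (τ : K →+ K))

theorem galMap_one (F : AddMonoidAlgebra ℤ K) : galMap 1 F = F :=
  congrArg (fun f => f F) (AddMonoidAlgebra.mapDomainRingHom_id (R := ℤ) (M := K))

end

theorem expEval_ne_zero {K : Type*} [Field K] [NumberField K] [IsGalois ℚ K] (φ : K →+* ℂ)
    {f : AddMonoidAlgebra ℤ K} (hf : f ≠ 0) : expEval φ f ≠ 0 := by
  classical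
  intro hev
  set N : AddMonoidAlgebra ℤ K := ∏ σ : K ≃ₐ[ℚ] K, galMap σ f with hN
  have hN0 : N ≠ 0 := Finset.prod_ne_zero_iff.mpr fun σ _ =>
    (map_ne_zero_iff _ (galMap_injective σ)).mpr hf
  have hNev : expEval φ N = 0 := by
    rw [hN, map_prod]
    exact Finset.prod_eq_zero (Finset.mem_univ 1) (by rw [galMap_one, hev])
  have hNinv (σ : K ≃ₐ[ℚ] K) : galMap σ N = N := by
    rw [hN, map_prod]
    exact Fintype.prod_equiv (Equiv.mulLeft σ) _ _ fun τ => by simp [galMap_mul]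
  obtain ⟨y, hy⟩ : ∃ y, N.coeff y ≠ 0 := by
    by_contra! h
    exact hN0 (by ext x; simp [h])
  have hNy (σ : K ≃ₐ[ℚ] K) : N.coeff (σ y) = N.coeff y := by
    conv_lhs => rw [← hNinv σ]
    exact coeff_galMap σ N y
  set O : AddMonoidAlgebra ℤ K := ∑ σ : K ≃ₐ[ℚ] K, AddMonoidAlgebra.single (-σ y) 1 with hO
  have hOinv (σ : K ≃ₐ[ℚ] K) : galMap σ O = O := by
    rw [hO, map_sum]
    exact Fintype.sum_equiv (Equiv.mulLeft σ) _ _ fun τ => by simp [galMap_single]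
  have hcoeff : (N * O).coeff 0 = Fintype.card (K ≃ₐ[ℚ] K) * N.coeff y := by
    have (σ : K ≃ₐ[ℚ] K) :
        (N * AddMonoidAlgebra.single (-σ y) 1).coeff 0 = N.coeff y := by
      rw [AddMonoidAlgebra.coeff_mul_single_eq_coeff_mul (σ y)
        (fun m' _ => by rw [add_neg_eq_zero]), hNy, mul_one]
    rw [hO, Finset.mul_sum, AddMonoidAlgebra.coeff_sum, Finsupp.finsetSum_apply]
    simp [this]
  refine sum_mul_exp_ne_zero_of_galois_invariant φ (N * O).coeff ?_ (fun σ x => ?_) ?_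
  · rw [hcoeff]
    exact mul_ne_zero (by exact_mod_cast Fintype.card_ne_zero) hy
  · conv_lhs => rw [← hNinv σ, ← hOinv σ, ← map_mul]
    exact coeff_galMap σ _ x
  · rw [← expEval_apply, map_mul, hNev, zero_mul]

open Polynomial in
theorem exists_galois_numberField_of_isAlgebraic (S : Finset ℂ) (hS : ∀ x ∈ S, IsAlgebraic ℚ x) :
    ∃ K : IntermediateField ℚ ℂ, FiniteDimensional ℚ K ∧ IsGalois ℚ K ∧ ∀ x ∈ S, x ∈ K := by
  set P : ℚ[X] := ∏ x ∈ S, minpoly ℚ x with hP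
  have hP0 : P ≠ 0 := Finset.prod_ne_zero_iff.mpr fun x hx => minpoly.ne_zero (hS x hx).isIntegral
  have hsplit : P.IsSplittingField ℚ (IntermediateField.adjoin ℚ (P.rootSet ℂ)) :=
    IntermediateField.adjoin_rootSet_isSplittingField (IsAlgClosed.splits _)
  have hnormal := Normal.of_isSplittingField
    (F := ℚ) (E := IntermediateField.adjoin ℚ (P.rootSet ℂ)) P
  refine ⟨IntermediateField.adjoin ℚ (P.rootSet ℂ), hsplit.finiteDimensional _ P, ⟨⟩,
    fun x hx => IntermediateField.subset_adjoin _ _ ?_⟩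
  rw [mem_rootSet]
  refine ⟨hP0, ?_⟩
  rw [hP, map_prod]
  exact Finset.prod_eq_zero hx (minpoly.aeval ℚ x)

/-- The Lindemann–Weierstrass theorem for real algebraic exponents and integer coefficients. -/
theorem eq_zero_of_sum_mul_exp_eq_zero (c : ℝ →₀ ℤ) (halg : ∀ x ∈ c.support, IsAlgebraic ℚ x)
    (hc : (c.sum fun x a => (a : ℝ) * Real.exp x) = 0) : c = 0 := by
  classical
  obtain ⟨K, hfin, hgal, hK⟩ := exists_galois_numberField_of_isAlgebraic
    (c.support.image ((↑) : ℝ → ℂ)) (by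
      simp only [Finset.mem_image]
      rintro _ ⟨x, hx, rfl⟩
      exact (halg x hx).algebraMap)
  have : NumberField K := { to_charZero := inferInstance, to_finiteDimensional := hfin }
  have hmem : ∀ x ∈ c.support, (x : ℂ) ∈ K := fun x hx => hK _ (Finset.mem_image_of_mem _ hx)
  let g : ℝ → K := fun x => if h : (x : ℂ) ∈ K then ⟨x, h⟩ else 0
  have hg : ∀ x ∈ c.support, (g x : ℂ) = x := fun x hx => by simp [g, hmem x hx]
  have hinj : Set.InjOn g c.support := fun x hx y hy hxy => by
    have := congrArg (fun z : K => (z : ℂ)) hxy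
    simp only [hg x hx, hg y hy] at this
    exact_mod_cast this
  by_contra hne
  have hf : AddMonoidAlgebra.ofCoeff (c.mapDomain g) ≠ 0 := by
    intro h
    have h' : c.mapDomain g = 0 := congrArg AddMonoidAlgebra.coeff h
    refine hne (Finsupp.mapDomain_injOn (c.support : Set ℝ) hinj
      (by simp) (by simp) ?_)
    rw [h', Finsupp.mapDomain_zero]
  refine expEval_ne_zero (algebraMap K ℂ) hf ?_
  rw [expEval_apply]
  change (c.mapDomain g).sum _ = 0
  rw [Finsupp.sum_mapDomain_index (by simp) (by intros; push_cast; ring), Finsupp.sum]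
  have := congrArg ((↑) : ℝ → ℂ) hc
  rw [Finsupp.sum] at this
  push_cast at this
  rw [← this]
  refine Finset.sum_congr rfl fun x hx => ?_
  have h := hg x hx
  change (c x : ℂ) * Complex.exp (g x : ℂ) = _
  rw [h]

theorem eq_of_sum_map_exp_eq {s t : Multiset ℝ} (hs : ∀ x ∈ s, IsAlgebraic ℚ x)
    (ht : ∀ x ∈ t, IsAlgebraic ℚ x) (h : (s.map Real.exp).sum = (t.map Real.exp).sum) :
    s = t := by
  classical
  have hsum (u : Multiset ℝ) (U : Finset ℝ) (hU : u.toFinset ⊆ U) :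
      (u.map Real.exp).sum = ∑ x ∈ U, (u.count x : ℝ) * Real.exp x := by
    rw [Finset.sum_multiset_map_count]
    simp only [nsmul_eq_mul]
    exact Finset.sum_subset hU fun x _ hx => by
      rw [Multiset.count_eq_zero_of_notMem (by simpa using hx)]; simp
  set U := s.toFinset ∪ t.toFinset with hU
  set c : ℝ →₀ ℤ := Finsupp.onFinset U (fun x => (s.count x : ℤ) - t.count x) (by
    intro x hx
    rw [hU, Finset.mem_union, Multiset.mem_toFinset, Multiset.mem_toFinset]
    by_contra! hx'
    simp [Multiset.count_eq_zero_of_notMem hx'.1, Multiset.count_eq_zero_of_notMem hx'.2] at hx)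
    with hc
  have hc0 : c = 0 := by
    refine eq_zero_of_sum_mul_exp_eq_zero c (fun x hx => ?_) ?_
    · have := Finsupp.support_onFinset_subset hx
      rw [hU, Finset.mem_union, Multiset.mem_toFinset, Multiset.mem_toFinset] at this
      exact this.elim (hs x) (ht x)
    · rw [hc, Finsupp.onFinset_sum _ (by simp)]
      rw [hsum s U Finset.subset_union_left, hsum t U Finset.subset_union_right] at h
      push_cast
      simp only [sub_mul, Finset.sum_sub_distrib, h, sub_self]
  ext x
  have := DFunLike.congr_fun hc0 x
  simp only [hc, Finsupp.onFinset_apply, Finsupp.zero_apply] at this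
  omega

theorem IsFFM.finite_divisors {M : AddSubmonoid ℝ} (hM : IsFFM (M : Set ℝ)) {x : ℝ} (hx : x ∈ M) :
    {y : ℝ | y ∈ M ∧ ∃ z ∈ M, x = y + z}.Finite := by
  have hfac : ∀ y ∈ M, ∃ s, s ∈ AddFactorizations (M : Set ℝ) y := fun y hy => by
    by_cases h0 : y = 0
    · exact ⟨0, by simp [AddFactorizations, h0]⟩
    · exact hM.1 y hy h0
  refine ((hM.2 x hx).biUnion fun f _ =>
    ((f.powerset.map Multiset.sum).finite_toSet)).subset ?_
  rintro y ⟨hy, z, hz, rfl⟩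
  obtain ⟨s, hs, rfl⟩ := hfac y hy
  obtain ⟨t, ht, rfl⟩ := hfac z hz
  simp only [Set.mem_iUnion]
  refine ⟨s + t, ⟨fun a ha => (Multiset.mem_add.mp ha).elim (hs a) (ht a), Multiset.sum_add s t⟩, ?_⟩
  exact Multiset.mem_map_of_mem _ (Multiset.mem_powerset.mpr (Multiset.le_add_right s t))

theorem Set.Finite.finite_multiset_card_le {α : Type*} {D : Set α} (hD : D.Finite) (n : ℕ) :
    {s : Multiset α | (∀ x ∈ s, x ∈ D) ∧ s.card ≤ n}.Finite := by
  classical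
  refine (n • hD.toFinset.val).powerset.finite_toSet.subset ?_
  rintro s ⟨hs, hn⟩
  refine Multiset.mem_powerset.mpr (Multiset.le_iff_count.mpr fun a => ?_)
  by_cases ha : a ∈ s
  · rw [Multiset.count_nsmul, Multiset.count_eq_one_of_mem hD.toFinset.nodup
      (hD.mem_toFinset.mpr (hs a ha)), mul_one]
    exact (Multiset.count_le_card a s).trans hn
  · simp [Multiset.count_eq_zero_of_notMem ha]

/-- The additive monoid of the exponentiation semiring of `M`. -/
def expSemiring (M : AddSubmonoid ℝ) : AddSubmonoid ℝ :=
  AddSubmonoid.closure (Real.exp '' (M : Set ℝ))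

section

variable {M : AddSubmonoid ℝ}

theorem exp_mem_expSemiring {x : ℝ} (hx : x ∈ M) : Real.exp x ∈ expSemiring M :=
  AddSubmonoid.subset_closure (Set.mem_image_of_mem _ hx)

theorem mem_expSemiring_iff {q : ℝ} :
    q ∈ expSemiring M ↔ ∃ s : Multiset ℝ, (∀ x ∈ s, x ∈ M) ∧ (s.map Real.exp).sum = q := by
  constructor
  · intro hq
    induction hq using AddSubmonoid.closure_induction with
    | mem x hx =>
      obtain ⟨m, hm, rfl⟩ := hx
      exact ⟨{m}, by simpa using hm, by simp⟩
    | zero => exact ⟨0, by simp, by simp⟩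
    | add x y _ _ hx hy =>
      obtain ⟨s, hs, rfl⟩ := hx
      obtain ⟨t, ht, rfl⟩ := hy
      exact ⟨s + t, fun a ha => (Multiset.mem_add.mp ha).elim (hs a) (ht a), by simp⟩
  · rintro ⟨s, hs, rfl⟩
    refine AddSubmonoid.multiset_sum_mem _ _ fun y hy => ?_
    obtain ⟨x, hx, rfl⟩ := Multiset.mem_map.mp hy
    exact exp_mem_expSemiring (hs x hx)

theorem sum_map_exp_mul_sum_map_exp (s t : Multiset ℝ) :
    (s.map Real.exp).sum * (t.map Real.exp).sum =
      ((s.bind fun x => t.map (x + ·)).map Real.exp).sum := by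
  simp [Multiset.map_bind, Multiset.sum_bind, Real.exp_add, Multiset.sum_map_mul_left,
    Multiset.sum_map_mul_right]

theorem mul_mem_expSemiring {a b : ℝ} (ha : a ∈ expSemiring M) (hb : b ∈ expSemiring M) :
    a * b ∈ expSemiring M := by
  obtain ⟨s, hs, rfl⟩ := mem_expSemiring_iff.mp ha
  obtain ⟨t, ht, rfl⟩ := mem_expSemiring_iff.mp hb
  refine mem_expSemiring_iff.mpr ⟨_, fun z hz => ?_, (sum_map_exp_mul_sum_map_exp s t).symm⟩
  obtain ⟨x, hx, hz⟩ := Multiset.mem_bind.mp hz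
  obtain ⟨y, hy, rfl⟩ := Multiset.mem_map.mp hz
  exact M.add_mem (hs x hx) (ht y hy)

theorem one_mem_expSemiring : (1 : ℝ) ∈ expSemiring M := by
  simpa using exp_mem_expSemiring M.zero_mem

theorem prod_mem_expSemiring {s : Multiset ℝ} (hs : ∀ a ∈ s, a ∈ expSemiring M) :
    s.prod ∈ expSemiring M :=
  Multiset.prod_induction (· ∈ expSemiring M) s (fun _ _ => mul_mem_expSemiring)
    one_mem_expSemiring hs

theorem one_le_of_mem_expSemiring (hpos : ∀ x ∈ M, (0 : ℝ) ≤ x) {q : ℝ} (hq : q ∈ expSemiring M)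
    (hq0 : q ≠ 0) : 1 ≤ q := by
  obtain ⟨s, hs, rfl⟩ := mem_expSemiring_iff.mp hq
  obtain ⟨x, hx⟩ := Multiset.exists_mem_of_ne_zero (s := s) (by rintro rfl; simp at hq0)
  refine (Real.one_le_exp (hpos x (hs x hx))).trans
    (Multiset.single_le_sum (fun y hy => ?_) _ (Multiset.mem_map_of_mem _ hx))
  obtain ⟨z, -, rfl⟩ := Multiset.mem_map.mp hy
  exact (Real.exp_pos z).le

/-- The divisors of `q` in the exponentiation semiring of `M`. -/
def expDivisors (M : AddSubmonoid ℝ) (q : ℝ) : Set ℝ :=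
  {a | a ∈ expSemiring M ∧ ∃ b ∈ expSemiring M, q = a * b}

theorem expDivisors_finite (halg : ∀ x ∈ M, IsAlgebraic ℚ x) (hFFM : IsFFM (M : Set ℝ)) {q : ℝ}
    (hq : q ∈ expSemiring M) (hq0 : q ≠ 0) : (expDivisors M q).Finite := by
  obtain ⟨u, hu, rfl⟩ := mem_expSemiring_iff.mp hq
  have hD : (⋃ x ∈ {x | x ∈ u}, {y : ℝ | y ∈ M ∧ ∃ z ∈ M, x = y + z}).Finite :=
    u.finite_toSet.biUnion fun x hx => hFFM.finite_divisors (hu x hx)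
  refine ((hD.finite_multiset_card_le u.card).image fun s => (s.map Real.exp).sum).subset ?_
  rintro a ⟨ha, b, hb, hab⟩
  obtain ⟨s, hs, rfl⟩ := mem_expSemiring_iff.mp ha
  obtain ⟨t, ht, rfl⟩ := mem_expSemiring_iff.mp hb
  have hmem : ∀ z ∈ s.bind fun x => t.map (x + ·), z ∈ M := fun z hz => by
    obtain ⟨x, hx, hz⟩ := Multiset.mem_bind.mp hz
    obtain ⟨y, hy, rfl⟩ := Multiset.mem_map.mp hz
    exact M.add_mem (hs x hx) (ht y hy)
  rw [sum_map_exp_mul_sum_map_exp] at hab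
  have hu_eq := eq_of_sum_map_exp_eq (fun x hx => halg x (hu x hx))
    (fun x hx => halg x (hmem x hx)) hab
  obtain ⟨y, hy⟩ := Multiset.exists_mem_of_ne_zero (s := t) (by
    rintro rfl
    simp [hab] at hq0)
  refine ⟨s, ⟨fun x hx => ?_, ?_⟩, rfl⟩
  · simp only [Set.mem_iUnion]
    refine ⟨x + y, ?_, hs x hx, y, ht y hy, rfl⟩
    change x + y ∈ u
    rw [hu_eq]
    exact Multiset.mem_bind.mpr ⟨x, hx, Multiset.mem_map_of_mem _ hy⟩
  · have hcard : u.card = s.card * t.card := by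
      rw [hu_eq]
      simp [Multiset.card_bind]
    rw [hcard]
    exact Nat.le_mul_of_pos_right _ (Multiset.card_pos_iff_exists_mem.mpr ⟨y, hy⟩)

theorem mulFactorizations_nonempty (hpos : ∀ x ∈ M, (0 : ℝ) ≤ x)
    (hdiv : ∀ q ∈ expSemiring M, q ≠ 0 → (expDivisors M q).Finite) {q : ℝ}
    (hq : q ∈ expSemiring M) (hq0 : q ≠ 0) :
    (MulFactorizations (expSemiring M : Set ℝ) q).Nonempty := by
  induction hn : (expDivisors M q).ncard using Nat.strong_induction_on generalizing q with
  | _ n ih =>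
    subst hn
    by_cases hq1 : q = 1
    · exact ⟨0, by simp [MulFactorizations, hq1]⟩
    by_cases hatom : IsMulAtom (expSemiring M : Set ℝ) q
    · exact ⟨{q}, by simpa [MulFactorizations] using hatom⟩
    have hfactor : ∀ b ∈ expSemiring M, ∀ c ∈ expSemiring M, q = b * c → c ≠ 1 →
        (MulFactorizations (expSemiring M : Set ℝ) b).Nonempty := by
      intro b hb c hc hbc hc1
      have hb0 : b ≠ 0 := by rintro rfl; simp [hbc] at hq0
      have hc0 : c ≠ 0 := by rintro rfl; simp [hbc] at hq0
      have hb1 := one_le_of_mem_expSemiring hpos hb hb0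
      have hc1' := (one_le_of_mem_expSemiring hpos hc hc0).lt_of_ne' hc1
      refine ih _ (Set.ncard_lt_ncard ⟨?_, fun hsub => ?_⟩ (hdiv q hq hq0)) hb hb0 rfl
      · rintro a ⟨ha, d, hd, rfl⟩
        exact ⟨ha, d * c, mul_mem_expSemiring hd hc, by rw [hbc, mul_assoc]⟩
      · obtain ⟨-, d, hd, hbd⟩ := hsub ⟨hq, 1, one_mem_expSemiring, (mul_one q).symm⟩
        have hd0 : d ≠ 0 := by rintro rfl; simp [hbd] at hb0
        have hd1 := one_le_of_mem_expSemiring hpos hd hd0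
        have hlt : b < q := by rw [hbc]; exact lt_mul_of_one_lt_right (by linarith) hc1'
        have hle : q ≤ b := by rw [hbd]; exact le_mul_of_one_le_right (by linarith) hd1
        exact absurd hlt hle.not_gt
    have : ∃ b ∈ expSemiring M, ∃ c ∈ expSemiring M, q = b * c ∧ b ≠ 1 ∧ c ≠ 1 := by
      by_contra! h
      refine hatom ⟨hq, hq0, hq1, fun b hb c hc hbc => ?_⟩
      by_cases hb1 : b = 1
      · exact Or.inl hb1
      · exact Or.inr (h b hb c hc hbc hb1)
    obtain ⟨b, hb, c, hc, hbc, hb1, hc1⟩ := this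
    obtain ⟨s, hs, hsb⟩ := hfactor b hb c hc hbc hc1
    obtain ⟨t, ht, htc⟩ := hfactor c hc b hb (by rw [hbc, mul_comm]) hb1
    exact ⟨s + t, fun a ha => (Multiset.mem_add.mp ha).elim (hs a) (ht a),
      by rw [Multiset.prod_add, hsb, htc, hbc]⟩

theorem mulFactorizations_finite (hpos : ∀ x ∈ M, (0 : ℝ) ≤ x) {q : ℝ}
    (hdiv : (expDivisors M q).Finite) :
    (MulFactorizations (expSemiring M : Set ℝ) q).Finite := by
  have hD : {a | a ∈ expDivisors M q ∧ 1 < a}.Finite := hdiv.subset fun a ha => ha.1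
  obtain ⟨δ, hδ1, hδ⟩ : ∃ δ : ℝ, 1 < δ ∧ ∀ a ∈ {a | a ∈ expDivisors M q ∧ 1 < a}, δ ≤ a := by
    rcases Set.eq_empty_or_nonempty {a | a ∈ expDivisors M q ∧ 1 < a} with h | h
    · exact ⟨2, by norm_num, by simp [h]⟩
    · obtain ⟨δ, hδ, hmin⟩ := Set.exists_min_image _ id hD h
      exact ⟨δ, hδ.2, hmin⟩
  obtain ⟨n, hn⟩ := pow_unbounded_of_one_lt q hδ1
  refine (hD.finite_multiset_card_le n).subset ?_
  rintro s ⟨hs, hsq⟩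
  have hmem : ∀ a ∈ s, a ∈ {a | a ∈ expDivisors M q ∧ 1 < a} := fun a ha => by
    obtain ⟨t, rfl⟩ := Multiset.exists_cons_of_mem ha
    refine ⟨⟨(hs a ha).1, t.prod, ?_, ?_⟩, ?_⟩
    · exact prod_mem_expSemiring fun b hb => (hs b (Multiset.mem_cons_of_mem hb)).1
    · rw [← hsq, Multiset.prod_cons]
    · exact (one_le_of_mem_expSemiring hpos (hs a ha).1 (hs a ha).2.1).lt_of_ne' (hs a ha).2.2.1
  refine ⟨hmem, ?_⟩
  have hle : δ ^ s.card ≤ q := by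
    rw [← hsq]
    clear hsq hs
    induction s using Multiset.induction_on with
    | empty => simp
    | cons a s ih =>
      rw [Multiset.card_cons, pow_succ', Multiset.prod_cons]
      exact mul_le_mul (hδ a (hmem a (Multiset.mem_cons_self a s)))
        (ih fun b hb => hmem b (Multiset.mem_cons_of_mem hb)) (by positivity)
        (by linarith [hδ a (hmem a (Multiset.mem_cons_self a s))])
  exact ((pow_lt_pow_iff_right₀ hδ1).mp (hle.trans_lt hn)).le

end

/-- If a positive monoid `M` of algebraic numbers is an FFM, then the exponentiation
semiring `E(M)` is a finite factorization semiring: its multiplicative monoid of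
nonzero elements is atomic, and each nonzero element has only finitely many
multiplicative factorizations. -/
theorem ffm_ascends_to_exponentiation_semiring
    (M : AddSubmonoid ℝ) (hpos : ∀ x ∈ M, (0 : ℝ) ≤ x)
    (halg : ∀ x ∈ M, IsAlgebraic ℚ x)
    (hFFM : IsFFM (M : Set ℝ)) :
    (∀ q ∈ AddSubmonoid.closure (Real.exp '' (M : Set ℝ)), q ≠ 0 →
      (MulFactorizations (AddSubmonoid.closure (Real.exp '' (M : Set ℝ)) : Set ℝ) q).Nonempty) ∧
    (∀ q ∈ AddSubmonoid.closure (Real.exp '' (M : Set ℝ)), q ≠ 0 →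
      (MulFactorizations
        (AddSubmonoid.closure (Real.exp '' (M : Set ℝ)) : Set ℝ) q).Finite) := by
  have hdiv : ∀ q ∈ expSemiring M, q ≠ 0 → (expDivisors M q).Finite :=
    fun _ hq hq0 => expDivisors_finite halg hFFM hq hq0
  exact ⟨fun _ hq hq0 => mulFactorizations_nonempty hpos hdiv hq hq0,
    fun q hq hq0 => mulFactorizations_finite hpos (hdiv q hq hq0)⟩
end

section
/- Let (p_n)_{n≥1} be a strictly increasing sequence of prime numbers, set a_n := 1 + (-1)^n / p_n for each n ∈ ℕ, and let M be the positive monoid generated by {a_n : n ∈ ℕ}. Then M is neither well-ordered nor co-well-ordered: there is no generating sequence of M that contains no strictly decreasing subsequence, and there is no generating sequence of M that contains no strictly increasing subsequence. -/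
/-- The real numbers `x` such that `k * x` is an integer for some natural number `k` prime to `q`. -/
def primeToDenominators (q : ℕ) (hq : q.Prime) : AddSubmonoid ℝ where
  carrier := {x | ∃ k : ℕ, ¬ q ∣ k ∧ ∃ m : ℤ, (k : ℝ) * x = m}
  zero_mem' := ⟨1, hq.one_lt.ne' ∘ Nat.dvd_one.mp, 0, by simp⟩
  add_mem' := by
    rintro x y ⟨k, hk, m, hm⟩ ⟨l, hl, n, hn⟩
    refine ⟨k * l, fun h => (hq.dvd_mul.mp h).elim hk hl, l * m + k * n, ?_⟩
    push_cast
    rw [← hm, ← hn]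
    ring

lemma one_add_div_mem_primeToDenominators {q r : ℕ} (hq : q.Prime) (hr : r.Prime) (hqr : q ≠ r)
    (n : ℕ) : (1 + (-1) ^ n / (r : ℝ)) ∈ primeToDenominators q hq := by
  have hr0 : (r : ℝ) ≠ 0 := Nat.cast_ne_zero.mpr hr.ne_zero
  refine ⟨r, fun h => hqr ((Nat.prime_dvd_prime_iff_eq hq hr).mp h), r + (-1) ^ n, ?_⟩
  push_cast
  field_simp

lemma one_add_div_notMem_primeToDenominators {q : ℕ} (hq : q.Prime) (n : ℕ) :
    (1 + (-1) ^ n / (q : ℝ)) ∉ primeToDenominators q hq := by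
  rintro ⟨k, hk, m, hm⟩
  have hq0 : (q : ℝ) ≠ 0 := Nat.cast_ne_zero.mpr hq.ne_zero
  have hR : (k : ℝ) * (q + (-1) ^ n) = q * m := by
    rw [← hm]
    field_simp
  have hZ : (k : ℤ) * (q + (-1) ^ n) = q * m := by exact_mod_cast hR
  apply hk
  rw [← Int.natCast_dvd_natCast]
  rcases neg_one_pow_eq_or ℤ n with h | h <;> rw [h] at hZ
  · exact ⟨m - k, by linarith⟩
  · exact ⟨k - m, by linarith⟩

/-- If `S` is a submonoid of `ℝ` and `U` is an upper set of `ℝ`, the nonnegative elements of `S ∪ U`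
form a submonoid. -/
def AddSubmonoid.nonnegUnionUpper (S : AddSubmonoid ℝ) (U : UpperSet ℝ) : AddSubmonoid ℝ where
  carrier := {x | 0 ≤ x ∧ (x ∈ S ∨ x ∈ U)}
  zero_mem' := ⟨le_rfl, Or.inl S.zero_mem⟩
  add_mem' := by
    rintro x y ⟨hx, hxSU⟩ ⟨hy, hySU⟩
    refine ⟨add_nonneg hx hy, ?_⟩
    rcases hxSU with hxSU | hxSU
    · rcases hySU with hySU | hySU
      · exact Or.inl (S.add_mem hxSU hySU)
      · exact Or.inr (U.upper (le_add_of_nonneg_left hx) hySU)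
    · exact Or.inr (U.upper (le_add_of_nonneg_right hy) hxSU)

/-- In a positive monoid with generating set `A`, a generator that does not belong to a submonoid
`S` containing all the other generators lies in every generating set. -/
lemma mem_of_closure_eq_closure {A B : Set ℝ} (hA : ∀ x ∈ A, 0 ≤ x)
    (hAB : AddSubmonoid.closure B = AddSubmonoid.closure A) {b : ℝ} (hb : b ∈ A)
    (S : AddSubmonoid ℝ) (hbS : b ∉ S) (hS : ∀ x ∈ A, x ≠ b → x ∈ S) : b ∈ B := by
  by_contra hbB
  have hle : AddSubmonoid.closure A ≤ S.nonnegUnionUpper (UpperSet.Ici b) := by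
    refine AddSubmonoid.closure_le.mpr fun x hx => ⟨hA x hx, ?_⟩
    by_cases hxb : x = b
    · exact Or.inr (UpperSet.mem_Ici_iff.mpr hxb.ge)
    · exact Or.inl (hS x hx hxb)
  have hlt : AddSubmonoid.closure B ≤ S.nonnegUnionUpper (UpperSet.Ioi b) := by
    refine AddSubmonoid.closure_le.mpr fun x hx => ?_
    have hxA : x ∈ AddSubmonoid.closure A := hAB ▸ AddSubmonoid.subset_closure hx
    obtain ⟨h0, h | h⟩ := hle hxA
    · exact ⟨h0, Or.inl h⟩
    · exact ⟨h0, Or.inr <| UpperSet.mem_Ioi_iff.mpr <|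
        (UpperSet.mem_Ici_iff.mp h).lt_of_ne fun hbx => hbB (hbx ▸ hx)⟩
  have hbmem : b ∈ AddSubmonoid.closure B := hAB ▸ AddSubmonoid.subset_closure hb
  obtain ⟨-, h | h⟩ := hlt hbmem
  · exact hbS h
  · exact lt_irrefl b (UpperSet.mem_Ioi_iff.mp h)

/-- A sequence which takes all the values of an injective sequence `u` has a subsequence which is
a subsequence of `u`. -/
lemma exists_strictMono_comp_eq {α : Type*} {f u : ℕ → α} (hu : Function.Injective u)
    (h : ∀ n, u n ∈ Set.range f) :
    ∃ φ ψ : ℕ → ℕ, StrictMono φ ∧ StrictMono ψ ∧ f ∘ φ = u ∘ ψ := by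
  choose g hg using h
  have hginj : Function.Injective g := fun m n hmn => hu (by rw [← hg m, ← hg n, hmn])
  obtain ⟨ψ, hψ, hgψ⟩ := Filter.strictMono_subseq_of_tendsto_atTop hginj.nat_tendsto_atTop
  exact ⟨g ∘ ψ, ψ, hgψ, hψ, funext fun n => hg (ψ n)⟩

/-- For a strictly increasing sequence of primes `(p_n)_{n ≥ 1}` and
`a_n := 1 + (-1)^n / p_n`, the positive monoid generated by `{a_n : n ≥ 1}` is
neither well-ordered nor co-well-ordered: no generating sequence of `M` is free of
strictly decreasing subsequences, and no generating sequence of `M` is free of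
strictly increasing subsequences. -/
theorem alternating_prime_monoid_not_wellOrdered_nor_coWellOrdered
    (p : ℕ → ℕ) (hp : ∀ n ∈ Set.Ici 1, (p n).Prime)
    (hmono : StrictMonoOn p (Set.Ici 1))
    (a : ℕ → ℝ) (ha : ∀ n, a n = 1 + (-1) ^ n / (p n : ℝ))
    (M : AddSubmonoid ℝ) (hgen : M = AddSubmonoid.closure (a '' Set.Ici 1)) :
    (¬ ∃ f : ℕ → ℝ, AddSubmonoid.closure (Set.range f) = M ∧
      ¬ ∃ φ : ℕ → ℕ, StrictMono φ ∧ StrictAnti (f ∘ φ)) ∧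
    (¬ ∃ f : ℕ → ℝ, AddSubmonoid.closure (Set.range f) = M ∧
      ¬ ∃ φ : ℕ → ℕ, StrictMono φ ∧ StrictMono (f ∘ φ)) := by
  have hpos : ∀ n ∈ Set.Ici 1, (0 : ℝ) < p n := fun n hn => Nat.cast_pos.mpr (hp n hn).pos
  have hnonneg : ∀ x ∈ a '' Set.Ici 1, 0 ≤ x := by
    rintro _ ⟨n, hn, rfl⟩
    have h1 : (1 : ℝ) / p n ≤ 1 :=
      (div_le_one (hpos n hn)).mpr (by exact_mod_cast (hp n hn).one_le)
    have h0 : (0 : ℝ) < 1 / p n := one_div_pos.mpr (hpos n hn)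
    rw [ha]
    rcases neg_one_pow_eq_or ℝ n with h | h <;> rw [h]
    · linarith
    · rw [neg_div]
      linarith
  have hmem : ∀ f : ℕ → ℝ, AddSubmonoid.closure (Set.range f) = M →
      ∀ n ∈ Set.Ici 1, a n ∈ Set.range f := by
    intro f hf n hn
    refine mem_of_closure_eq_closure hnonneg (hf.trans hgen) ⟨n, hn, rfl⟩
      (primeToDenominators (p n) (hp n hn)) ?_ ?_
    · rw [ha]
      exact one_add_div_notMem_primeToDenominators (hp n hn) n
    · rintro _ ⟨m, hm, rfl⟩ hmn
      rw [ha m]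
      refine one_add_div_mem_primeToDenominators (hp n hn) (hp m hm) (fun h => hmn ?_) m
      rw [hmono.injOn hn hm h]
  have hinv : ∀ m ∈ Set.Ici 1, ∀ n ∈ Set.Ici 1, m < n → (1 : ℝ) / p n < 1 / p m :=
    fun m hm n hn hmn =>
      one_div_lt_one_div_of_lt (hpos m hm) (Nat.cast_lt.mpr (hmono hm hn hmn))
  have heven : StrictAnti fun k : ℕ => a (2 * k + 2) := fun k l hkl => by
    have h := hinv (2 * k + 2) (by simp) (2 * l + 2) (by simp) (by lia)
    simp only [ha, Even.neg_one_pow (show Even (2 * k + 2) from ⟨k + 1, by ring⟩),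
      Even.neg_one_pow (show Even (2 * l + 2) from ⟨l + 1, by ring⟩)]
    linarith
  have hodd : StrictMono fun k : ℕ => a (2 * k + 1) := fun k l hkl => by
    have h := hinv (2 * k + 1) (by simp) (2 * l + 1) (by simp) (by lia)
    simp only [ha, Odd.neg_one_pow (odd_two_mul_add_one _), neg_div]
    linarith
  constructor
  · rintro ⟨f, hf, hno⟩
    obtain ⟨φ, ψ, hφ, hψ, h⟩ :=
      exists_strictMono_comp_eq heven.injective fun k => hmem f hf (2 * k + 2) (by simp)
    exact hno ⟨φ, hφ, h ▸ heven.comp_strictMono hψ⟩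
  · rintro ⟨f, hf, hno⟩
    obtain ⟨φ, ψ, hφ, hψ, h⟩ :=
      exists_strictMono_comp_eq hodd.injective fun k => hmem f hf (2 * k + 1) (by simp)
    exact hno ⟨φ, hφ, h ▸ hodd.comp hψ⟩
end

section
/- Let (p_n)_{n≥0} be the strictly increasing sequence whose underlying set is the set of odd primes, and let M be the positive monoid generated by {1/(2^n p_n) : n ∈ ℕ₀} (the Grams monoid). Then M is a length-finite factorization monoid (LFFM) but does not satisfy the ascending chain condition on principal ideals (ACCP): the ascending chain of principal ideals (1/2^n + M)_{n≥0} does not stabilize. -/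
/-- The `n`-th generator `1 / (2 ^ n * p n)` of the Grams monoid of the sequence `p`. -/
noncomputable def gramsGen (p : ℕ → ℕ) (n : ℕ) : ℝ :=
  1 / (2 ^ n * (p n : ℝ))

section

variable {p : ℕ → ℕ}

theorem gramsGen_pos (hp : ∀ n, (p n).Prime) (n : ℕ) : 0 < gramsGen p n := by
  have := (hp n).pos
  unfold gramsGen
  positivity

/-- An integral linear relation among finitely many generators has its `n`-th coefficient
divisible by `p n`. -/
theorem dvd_of_sum_mul_gramsGen_eq_zero (hp : ∀ n, (p n).Prime) (hodd : ∀ n, p n ≠ 2)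
    (hinj : Function.Injective p) (S : Finset ℕ) (f : ℕ → ℤ)
    (hf : ∑ i ∈ S, (f i : ℝ) * gramsGen p i = 0) {n : ℕ} (hn : n ∈ S) :
    (p n : ℤ) ∣ f n := by
  have hprime : Prime (p n : ℤ) := Nat.prime_iff_prime_int.mp (hp n)
  set N := S.sup id
  have hN : ∀ i ∈ S, i ≤ N := fun i hi => Finset.le_sup (f := id) hi
  have hcleared : ∑ i ∈ S, f i * (2 ^ (N - i) * ∏ j ∈ S.erase i, (p j : ℤ)) = 0 := by
    have h : (2 ^ N * ∏ j ∈ S, (p j : ℝ)) * ∑ i ∈ S, (f i : ℝ) * gramsGen p i = 0 := by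
      rw [hf, mul_zero]
    rw [Finset.mul_sum] at h
    have h' : ((∑ i ∈ S, f i * (2 ^ (N - i) * ∏ j ∈ S.erase i, (p j : ℤ)) : ℤ) : ℝ) = 0 := by
      rw [← h]
      push_cast
      refine Finset.sum_congr rfl fun i hi => ?_
      have hpi : (p i : ℝ) ≠ 0 := by exact_mod_cast (hp i).ne_zero
      rw [← Finset.mul_prod_erase S (fun j => (p j : ℝ)) hi, gramsGen,
        ← Nat.sub_add_cancel (hN i hi), pow_add, Nat.add_sub_cancel]
      field_simp
    exact_mod_cast h'
  have hrest : (p n : ℤ) ∣ ∑ i ∈ S.erase n, f i * (2 ^ (N - i) * ∏ j ∈ S.erase i, (p j : ℤ)) := by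
    refine Finset.dvd_sum fun i hi => ((Finset.dvd_prod_of_mem (fun j => (p j : ℤ)) ?_).mul_left
      _).mul_left _
    exact Finset.mem_erase.mpr ⟨(Finset.ne_of_mem_erase hi).symm, hn⟩
  rw [← Finset.add_sum_erase S _ hn] at hcleared
  have hterm : (p n : ℤ) ∣ f n * (2 ^ (N - n) * ∏ j ∈ S.erase n, (p j : ℤ)) := by
    rw [eq_neg_of_add_eq_zero_left hcleared]
    exact hrest.neg_right
  rcases hprime.dvd_or_dvd hterm with h | h
  · exact h
  rcases hprime.dvd_or_dvd h with h | h
  · have h2 : p n ∣ 2 := by exact_mod_cast hprime.dvd_of_dvd_pow h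
    exact absurd ((Nat.prime_dvd_prime_iff_eq (hp n) Nat.prime_two).mp h2) (hodd n)
  · obtain ⟨j, hj, hdvd⟩ := (hprime.dvd_finsetProd_iff _).mp h
    have hd : p n ∣ p j := by exact_mod_cast hdvd
    exact absurd (hinj ((Nat.prime_dvd_prime_iff_eq (hp n) (hp j)).mp hd)).symm
      (Finset.ne_of_mem_erase hj)

/-- Two multisets of generators with the same sum contain the `n`-th generator equally often
modulo `p n`. -/
theorem dvd_count_sub_count (hp : ∀ n, (p n).Prime) (hodd : ∀ n, p n ≠ 2)
    (hinj : Function.Injective p) {t u : Multiset ℕ}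
    (h : (t.map (gramsGen p)).sum = (u.map (gramsGen p)).sum) (n : ℕ) :
    (p n : ℤ) ∣ (t.count n : ℤ) - u.count n := by
  have hsum : ∀ v : Multiset ℕ, ∀ S : Finset ℕ, v.toFinset ⊆ S →
      (v.map (gramsGen p)).sum = ∑ i ∈ S, (v.count i : ℝ) * gramsGen p i := by
    intro v S hS
    rw [Finset.sum_multiset_map_count]
    simp only [nsmul_eq_mul]
    refine Finset.sum_subset hS fun i _ hi => ?_
    rw [Multiset.count_eq_zero_of_notMem (by simpa using hi)]
    simp
  set S := insert n (t.toFinset ∪ u.toFinset)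
  have ht : t.toFinset ⊆ S := Finset.subset_union_left.trans (Finset.subset_insert _ _)
  have hu : u.toFinset ⊆ S := Finset.subset_union_right.trans (Finset.subset_insert _ _)
  refine dvd_of_sum_mul_gramsGen_eq_zero hp hodd hinj S
    (fun i => (t.count i : ℤ) - u.count i) ?_ (Finset.mem_insert_self _ _)
  rw [hsum t S ht, hsum u S hu, ← sub_eq_zero, ← Finset.sum_sub_distrib] at h
  rw [← h]
  refine Finset.sum_congr rfl fun i _ => ?_
  push_cast
  ring

theorem mem_closure_range_iff_exists_multiset {ι A : Type*} [AddCommMonoid A] {g : ι → A} {x : A} :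
    x ∈ AddSubmonoid.closure (Set.range g) ↔ ∃ t : Multiset ι, (t.map g).sum = x := by
  constructor
  · intro hx
    induction hx using AddSubmonoid.closure_induction with
    | mem x hx =>
      obtain ⟨i, rfl⟩ := hx
      exact ⟨{i}, by simp⟩
    | zero => exact ⟨0, by simp⟩
    | add x y _ _ hx hy =>
      obtain ⟨t, rfl⟩ := hx
      obtain ⟨u, rfl⟩ := hy
      exact ⟨t + u, by simp⟩
  · rintro ⟨t, rfl⟩
    refine AddSubmonoid.multiset_sum_mem _ _ fun a ha => ?_
    obtain ⟨i, _, rfl⟩ := Multiset.mem_map.mp ha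
    exact AddSubmonoid.subset_closure ⟨i, rfl⟩

theorem sum_map_gramsGen_nonneg (hp : ∀ n, (p n).Prime) (t : Multiset ℕ) :
    0 ≤ (t.map (gramsGen p)).sum := by
  refine Multiset.sum_nonneg fun a ha => ?_
  obtain ⟨i, _, rfl⟩ := Multiset.mem_map.mp ha
  exact (gramsGen_pos hp i).le

theorem eq_zero_of_sum_map_gramsGen_eq_zero (hp : ∀ n, (p n).Prime) {t : Multiset ℕ}
    (h : (t.map (gramsGen p)).sum = 0) : t = 0 := by
  induction t using Multiset.induction with
  | empty => rfl
  | cons n t _ =>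
    rw [Multiset.map_cons, Multiset.sum_cons] at h
    linarith [gramsGen_pos hp n, sum_map_gramsGen_nonneg hp t]

theorem isAddAtom_gramsGen (hp : ∀ n, (p n).Prime) (hodd : ∀ n, p n ≠ 2)
    (hinj : Function.Injective p) (n : ℕ) :
    IsAddAtom (AddSubmonoid.closure (Set.range (gramsGen p)) : Set ℝ) (gramsGen p n) := by
  refine ⟨AddSubmonoid.subset_closure ⟨n, rfl⟩, (gramsGen_pos hp n).ne', ?_⟩
  intro b hb c hc hbc
  obtain ⟨t, rfl⟩ := mem_closure_range_iff_exists_multiset.mp hb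
  obtain ⟨u, rfl⟩ := mem_closure_range_iff_exists_multiset.mp hc
  have hsum : ((t + u).map (gramsGen p)).sum = (({n} : Multiset ℕ).map (gramsGen p)).sum := by
    simp [hbc]
  have hmem : n ∈ t + u := by
    by_contra hn
    have hdvd := dvd_count_sub_count hp hodd hinj hsum n
    rw [Multiset.count_eq_zero_of_notMem hn, Multiset.count_singleton_self] at hdvd
    have h1 : p n ∣ 1 := by
      rw [← Int.natCast_dvd_natCast]
      simpa using hdvd
    exact (hp n).one_lt.ne' (Nat.dvd_one.mp h1)
  have hle : ∀ v : Multiset ℕ, n ∈ v → gramsGen p n ≤ (v.map (gramsGen p)).sum := by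
    intro v hv
    obtain ⟨w, rfl⟩ := Multiset.exists_cons_of_mem hv
    rw [Multiset.map_cons, Multiset.sum_cons]
    linarith [sum_map_gramsGen_nonneg hp w]
  have ht := sum_map_gramsGen_nonneg hp t
  have hu := sum_map_gramsGen_nonneg hp u
  rcases Multiset.mem_add.mp hmem with h | h
  · right
    linarith [hle t h]
  · left
    linarith [hle u h]

/-- Every atom of the Grams monoid is one of the generators. -/
theorem IsAddAtom.exists_gramsGen_eq (hp : ∀ n, (p n).Prime) {a : ℝ}
    (ha : IsAddAtom (AddSubmonoid.closure (Set.range (gramsGen p)) : Set ℝ) a) :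
    ∃ n, gramsGen p n = a := by
  obtain ⟨hmem, hne, hirr⟩ := ha
  obtain ⟨t, rfl⟩ := mem_closure_range_iff_exists_multiset.mp hmem
  induction t using Multiset.induction with
  | empty => simp at hne
  | cons n t _ =>
    rw [Multiset.map_cons, Multiset.sum_cons] at hirr ⊢
    rcases hirr _ (AddSubmonoid.subset_closure ⟨n, rfl⟩) _
      (mem_closure_range_iff_exists_multiset.mpr ⟨t, rfl⟩) rfl with h | h
    · exact absurd h (gramsGen_pos hp n).ne'
    · exact ⟨n, by rw [h, add_zero]⟩

theorem isLFFM_closure_range_gramsGen (hp : ∀ n, (p n).Prime) (hodd : ∀ n, p n ≠ 2)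
    (hmono : StrictMono p) :
    IsLFFM (AddSubmonoid.closure (Set.range (gramsGen p)) : Set ℝ) := by
  constructor
  · intro x hx _
    obtain ⟨t, rfl⟩ := mem_closure_range_iff_exists_multiset.mp hx
    refine ⟨t.map (gramsGen p), fun a ha => ?_, rfl⟩
    obtain ⟨n, _, rfl⟩ := Multiset.mem_map.mp ha
    exact isAddAtom_gramsGen hp hodd hmono.injective n
  · intro x hx ℓ
    obtain ⟨u, rfl⟩ := mem_closure_range_iff_exists_multiset.mp hx
    refine ((Set.finite_Iic (ℓ • Multiset.range (ℓ + u.sum + 1))).image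
      (Multiset.map (gramsGen p))).subset ?_
    rintro s ⟨⟨hatom, hsum⟩, hcard⟩
    have hlift : ∀ a ∈ s, ∃ n, gramsGen p n = a := fun a ha => (hatom a ha).exists_gramsGen_eq hp
    obtain ⟨t, rfl⟩ : ∃ t : Multiset ℕ, t.map (gramsGen p) = s := by
      choose! f hf using hlift
      refine ⟨s.map f, ?_⟩
      rw [Multiset.map_map]
      exact (Multiset.map_congr rfl hf).trans (Multiset.map_id' s)
    rw [Multiset.card_map] at hcard
    refine ⟨t, Multiset.le_iff_count.mpr fun n => ?_, rfl⟩
    have hcount : t.count n ≤ ℓ := hcard ▸ Multiset.count_le_card n t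
    rw [Multiset.count_nsmul]
    rcases lt_or_ge n (ℓ + u.sum + 1) with hn | hn
    · rwa [Multiset.count_eq_one_of_mem (Multiset.nodup_range _) (Multiset.mem_range.mpr hn),
        mul_one]
    · have hnu : n ∉ u := fun h => by
        have := Multiset.le_sum_of_mem h
        omega
      have hdvd := dvd_count_sub_count hp hodd hmono.injective hsum n
      rw [Multiset.count_eq_zero_of_notMem hnu, Nat.cast_zero, sub_zero,
        Int.natCast_dvd_natCast] at hdvd
      have hlt : t.count n < p n := by
        have := hmono.le_apply (x := n)
        omega
      rw [Nat.eq_zero_of_dvd_of_lt hdvd hlt]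
      exact Nat.zero_le _

theorem one_div_two_pow_mem_closure_range_gramsGen (hp : ∀ n, (p n).Prime) (n : ℕ) :
    (1 : ℝ) / 2 ^ n ∈ AddSubmonoid.closure (Set.range (gramsGen p)) := by
  have hpn : (p n : ℝ) ≠ 0 := by exact_mod_cast (hp n).ne_zero
  have h : (1 : ℝ) / 2 ^ n = p n • gramsGen p n := by
    rw [gramsGen, nsmul_eq_mul]
    field_simp
  rw [h]
  exact nsmul_mem (AddSubmonoid.subset_closure (Set.mem_range_self n)) _

end

/-- The Grams monoid, generated by `{1/(2^n p_n) : n ∈ ℕ₀}` where `(p_n)` enumerates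
the odd primes in increasing order, is an LFFM, but the ascending chain of principal
ideals `(1/2^n + M)` does not stabilize, so the ACCP fails. -/
theorem grams_monoid_isLFFM_not_ACCP
    (p : ℕ → ℕ) (hmono : StrictMono p)
    (hrange : Set.range p = {q : ℕ | q.Prime ∧ q ≠ 2})
    (M : AddSubmonoid ℝ)
    (hgen : M = AddSubmonoid.closure {x : ℝ | ∃ n : ℕ, x = 1 / (2 ^ n * (p n : ℝ))}) :
    IsLFFM (M : Set ℝ) ∧
    (∀ n : ℕ, (fun y => (1 : ℝ) / 2 ^ n + y) '' (M : Set ℝ) ⊆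
      (fun y => (1 : ℝ) / 2 ^ (n + 1) + y) '' (M : Set ℝ)) ∧
    ¬ ∃ N : ℕ, ∀ n ≥ N, (fun y => (1 : ℝ) / 2 ^ n + y) '' (M : Set ℝ) =
      (fun y => (1 : ℝ) / 2 ^ N + y) '' (M : Set ℝ) := by
  have hprop : ∀ n, (p n).Prime ∧ p n ≠ 2 := fun n => hrange.le (Set.mem_range_self n)
  have hp : ∀ n, (p n).Prime := fun n => (hprop n).1
  have hM : M = AddSubmonoid.closure (Set.range (gramsGen p)) := by
    rw [hgen]
    congr 1
    ext x
    exact exists_congr fun n => eq_comm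
  subst hM
  refine ⟨isLFFM_closure_range_gramsGen hp (fun n => (hprop n).2) hmono, ?_, ?_⟩
  · rintro n _ ⟨y, hy, rfl⟩
    refine ⟨1 / 2 ^ (n + 1) + y,
      add_mem (one_div_two_pow_mem_closure_range_gramsGen hp (n + 1)) hy, ?_⟩
    simp only [pow_succ]
    field_simp
    ring
  · rintro ⟨N, hN⟩
    have hmem : (1 : ℝ) / 2 ^ (N + 1) ∈ (fun y => (1 : ℝ) / 2 ^ N + y) ''
        (AddSubmonoid.closure (Set.range (gramsGen p)) : Set ℝ) := by
      rw [← hN (N + 1) N.le_succ]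
      exact ⟨0, zero_mem _, add_zero _⟩
    obtain ⟨y, hy, hyN⟩ := hmem
    obtain ⟨t, rfl⟩ := mem_closure_range_iff_exists_multiset.mp hy
    have hlt : (1 : ℝ) / 2 ^ (N + 1) < 1 / 2 ^ N :=
      one_div_pow_lt_one_div_pow_of_lt one_lt_two N.lt_succ_self
    have hnonneg := sum_map_gramsGen_nonneg hp t
    simp only at hyN
    linarith
end

section
/- Let M be the positive monoid {0} ∪ ℚ_{≥1} = {x ∈ ℚ : x ≥ 1} ∪ {0}. Then the set of atoms of M is exactly ℚ ∩ [1, 2), and M is atomic. -/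
theorem isAddAtom_zero_union_rat_ge_one_iff (a : ℝ) :
    IsAddAtom {x : ℝ | x = 0 ∨ ((∃ t : ℚ, x = (t : ℝ)) ∧ 1 ≤ x)} a ↔
      (∃ t : ℚ, a = (t : ℝ)) ∧ 1 ≤ a ∧ a < 2 := by
  constructor
  · rintro ⟨ha, h0, h⟩
    obtain ⟨⟨t, ht⟩, h1⟩ := ha.resolve_left h0
    refine ⟨⟨t, ht⟩, h1, ?_⟩
    by_contra! h2
    rcases h 1 (Or.inr ⟨⟨1, by simp⟩, le_rfl⟩) (a - 1)
      (Or.inr ⟨⟨t - 1, by rw [ht]; push_cast; rfl⟩, by linarith⟩) (by ring) with h | h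
    · exact one_ne_zero h
    · linarith
  · rintro ⟨hq, h1, h2⟩
    refine ⟨Or.inr ⟨hq, h1⟩, by linarith, ?_⟩
    rintro b (hb | ⟨-, hb⟩) c (hc | ⟨-, hc⟩) h
    · exact Or.inl hb
    · exact Or.inl hb
    · exact Or.inr hc
    · linarith

/-- For the positive monoid `M = {0} ∪ ℚ_{≥1}`, the set of atoms of `M` is exactly
`ℚ ∩ [1, 2)`, and `M` is atomic. -/
theorem atoms_of_zero_union_rat_ge_one :
    {a : ℝ | IsAddAtom {x : ℝ | x = 0 ∨ ((∃ t : ℚ, x = (t : ℝ)) ∧ 1 ≤ x)} a} =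
      {x : ℝ | ∃ t : ℚ, x = (t : ℝ)} ∩ Set.Ico (1 : ℝ) 2 ∧
    IsAddAtomic {x : ℝ | x = 0 ∨ ((∃ t : ℚ, x = (t : ℝ)) ∧ 1 ≤ x)} := by
  refine ⟨Set.ext isAddAtom_zero_union_rat_ge_one_iff, fun x hx h0 => ?_⟩
  obtain ⟨⟨t, ht⟩, h1⟩ := hx.resolve_left h0
  have hn : (1 : ℝ) ≤ (⌊x⌋₊ : ℝ) := by
    exact_mod_cast Nat.one_le_floor_iff x |>.2 h1
  have hle : (⌊x⌋₊ : ℝ) ≤ x := Nat.floor_le (by linarith)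
  have hlt : x < (⌊x⌋₊ : ℝ) + 1 := Nat.lt_floor_add_one x
  generalize ⌊x⌋₊ = n at hn hle hlt
  have hpos : (0 : ℝ) < n := by linarith
  refine ⟨Multiset.replicate n (x / n), fun a ha => ?_, ?_⟩
  · rw [Multiset.eq_of_mem_replicate ha, isAddAtom_zero_union_rat_ge_one_iff]
    refine ⟨⟨t / n, by rw [ht]; push_cast; rfl⟩, ?_, ?_⟩
    · rwa [one_le_div hpos]
    · rw [div_lt_iff₀ hpos]
      linarith
  · rw [Multiset.sum_replicate, nsmul_eq_mul, mul_div_cancel₀ _ hpos.ne']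
end

section
/- Let M be the positive monoid {0} ∪ ℚ_{≥1} = {x ∈ ℚ : x ≥ 1} ∪ {0}. Then M is a bounded factorization monoid (BFM) but not a length-finite factorization monoid (LFFM): for every x ∈ M the set of lengths of factorizations of x is finite, yet the element 3 has infinitely many factorizations of length 2 (namely 3 = (3/2 − 1/n) + (3/2 + 1/n) for every integer n ≥ 3). -/
/-- The positive monoid `{0} ∪ ℚ_{≥1}`. -/
def zeroUnionRatGeOne : Set ℝ :=
  {x : ℝ | x = 0 ∨ ((∃ t : ℚ, x = (t : ℝ)) ∧ 1 ≤ x)}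

lemma one_le_of_isAddAtom {a : ℝ} (ha : IsAddAtom zeroUnionRatGeOne a) : 1 ≤ a := by
  obtain ⟨h | h, h0, -⟩ := ha
  · exact absurd h h0
  · exact h.2

lemma isAddAtom_ratCast {t : ℚ} (h1 : 1 ≤ (t : ℝ)) (h2 : (t : ℝ) < 2) :
    IsAddAtom zeroUnionRatGeOne t := by
  refine ⟨Or.inr ⟨⟨t, rfl⟩, h1⟩, by linarith, ?_⟩
  rintro b (hb | hb) c (hc | hc) h
  · exact Or.inl hb
  · exact Or.inl hb
  · exact Or.inr hc
  · linarith [hb.2, hc.2]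

/-- Every nonzero element is a sum of ones and a single element of `[1, 2)`. -/
lemma isAddAtomic_zeroUnionRatGeOne : IsAddAtomic zeroUnionRatGeOne := by
  rintro _ (hx | ⟨⟨t, rfl⟩, h1⟩) h0
  · exact absurd hx h0
  obtain ⟨k, hk⟩ : ∃ k : ℕ, ⌊(t : ℝ)⌋₊ = k + 1 :=
    Nat.exists_eq_succ_of_ne_zero (Nat.floor_pos.2 h1).ne'
  have hle := Nat.floor_le (zero_le_one.trans h1)
  have hlt := Nat.lt_floor_add_one (t : ℝ)
  rw [hk] at hle hlt
  push_cast at hle hlt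
  refine ⟨((t - k : ℚ) : ℝ) ::ₘ Multiset.replicate k 1, ?_, ?_⟩
  · intro a ha
    rcases Multiset.mem_cons.1 ha with rfl | ha
    · apply isAddAtom_ratCast <;> push_cast <;> linarith
    · rw [Multiset.eq_of_mem_replicate ha]
      exact_mod_cast isAddAtom_ratCast (t := 1) (by norm_num) (by norm_num)
  · simp

lemma card_le_of_mem_addFactorizations {x : ℝ} {s : Multiset ℝ}
    (hs : s ∈ AddFactorizations zeroUnionRatGeOne x) : (Multiset.card s : ℝ) ≤ x := by
  have h := Multiset.card_nsmul_le_sum fun a ha => one_le_of_isAddAtom (hs.1 a ha)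
  rwa [hs.2, nsmul_one] at h

lemma isBFM_zeroUnionRatGeOne : IsBFM zeroUnionRatGeOne := by
  refine ⟨isAddAtomic_zeroUnionRatGeOne, fun x _ => (Set.finite_Iic ⌊x⌋₊).subset ?_⟩
  rintro _ ⟨s, hs, rfl⟩
  exact Nat.le_floor (card_le_of_mem_addFactorizations hs)

lemma pair_mem_addFactorizations_three (n : ℕ) (hn : 3 ≤ n) :
    ({(3 / 2 - 1 / (n : ℝ)), (3 / 2 + 1 / (n : ℝ))} : Multiset ℝ) ∈
      AddFactorizations zeroUnionRatGeOne 3 := by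
  have hpos : 0 ≤ 1 / (n : ℝ) := by positivity
  have hle : 1 / (n : ℝ) ≤ 1 / 3 :=
    one_div_le_one_div_of_le (by norm_num) (by exact_mod_cast hn)
  refine ⟨?_, ?_⟩
  · intro a ha
    simp only [Multiset.insert_eq_cons, Multiset.mem_cons, Multiset.mem_singleton] at ha
    rcases ha with rfl | rfl
    · have h := isAddAtom_ratCast (t := 3 / 2 - 1 / n)
      push_cast at h
      exact h (by linarith) (by linarith)
    · have h := isAddAtom_ratCast (t := 3 / 2 + 1 / n)
      push_cast at h
      exact h (by linarith) (by linarith)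
  · rw [Multiset.insert_eq_cons, Multiset.sum_cons, Multiset.sum_singleton]
    ring

lemma infinite_addFactorizations_three_card_two :
    {s ∈ AddFactorizations zeroUnionRatGeOne 3 | Multiset.card s = 2}.Infinite := by
  refine Set.infinite_of_injective_forall_mem
    (f := fun n : ℕ => ({3 / 2 - 1 / ((n + 3 : ℕ) : ℝ), 3 / 2 + 1 / ((n + 3 : ℕ) : ℝ)} :
      Multiset ℝ)) ?_
    fun n => ⟨pair_mem_addFactorizations_three (n + 3) (Nat.le_add_left 3 n),
      Multiset.card_pair _ _⟩
  intro m n h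
  have hm : 0 < 1 / ((m + 3 : ℕ) : ℝ) := by positivity
  have hn : 0 < 1 / ((n + 3 : ℕ) : ℝ) := by positivity
  have hmem : 3 / 2 + 1 / ((m + 3 : ℕ) : ℝ) ∈
      ({3 / 2 - 1 / ((n + 3 : ℕ) : ℝ), 3 / 2 + 1 / ((n + 3 : ℕ) : ℝ)} : Multiset ℝ) := by
    dsimp only at h
    rw [← h]
    simp
  simp only [Multiset.insert_eq_cons, Multiset.mem_cons, Multiset.mem_singleton] at hmem
  rcases hmem with hmem | hmem
  · linarith
  · rw [add_right_inj, one_div, one_div, inv_inj, Nat.cast_inj] at hmem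
    exact Nat.add_right_cancel hmem

lemma not_isLFFM_zeroUnionRatGeOne : ¬ IsLFFM zeroUnionRatGeOne := fun h =>
  infinite_addFactorizations_three_card_two
    (h.2 3 (Or.inr ⟨⟨3, by norm_num⟩, by norm_num⟩) 2)

/-- The positive monoid `M = {0} ∪ ℚ_{≥1}` is a BFM but not an LFFM: the element `3`
has infinitely many factorizations of length `2`, namely
`3 = (3/2 − 1/n) + (3/2 + 1/n)` for every integer `n ≥ 3`. -/
theorem zero_union_rat_ge_one_isBFM_not_isLFFM :
    IsBFM {x : ℝ | x = 0 ∨ ((∃ t : ℚ, x = (t : ℝ)) ∧ 1 ≤ x)} ∧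
    ¬ IsLFFM {x : ℝ | x = 0 ∨ ((∃ t : ℚ, x = (t : ℝ)) ∧ 1 ≤ x)} ∧
    {s ∈ AddFactorizations {x : ℝ | x = 0 ∨ ((∃ t : ℚ, x = (t : ℝ)) ∧ 1 ≤ x)} 3 |
      Multiset.card s = 2}.Infinite ∧
    ∀ n : ℕ, 3 ≤ n →
      ({(3 / 2 - 1 / (n : ℝ)), (3 / 2 + 1 / (n : ℝ))} : Multiset ℝ) ∈
        AddFactorizations {x : ℝ | x = 0 ∨ ((∃ t : ℚ, x = (t : ℝ)) ∧ 1 ≤ x)} 3 := by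
  exact ⟨isBFM_zeroUnionRatGeOne, not_isLFFM_zeroUnionRatGeOne,
    infinite_addFactorizations_three_card_two, pair_mem_addFactorizations_three⟩
end
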